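/- arXiv:2106.05305 — 2 statements merged into one kernel-verified Lean document; each statement's English description precedes it below -/
import Mathlib

section
/- Let n ≥ 2 and let A be an n-qubit architecture with R = T·L gates that is the concatenation of T consecutive causal slices of L gates each, where T ≤ 4^n − 1. Then the accessible dimension of A is lower-bounded as d_A ≥ T = R/L. -/
open scoped Matrix ENNReal Classical Kronecker ComplexOrder
open MeasureTheory

/-! ## Basic objects: qubit bases, gates, architectures, contraction maps -/

/-- Computational-basis index set for `n` qubits. -/
abbrev QubitBasis (n : ℕ) := Fin n → Fin 2

/-- `2^n × 2^n` complex matrices, indexed by the computational basis of `n` qubits. -/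
abbrev NMatrix (n : ℕ) := Matrix (QubitBasis n) (QubitBasis n) ℂ

/-- The special unitary group `SU(4)` of two-qubit gates. -/
abbrev SU4 := Matrix.specialUnitaryGroup (Fin 4) ℂ

/-- An architecture on `n` qubits with `R` gates: a list of ordered pairs of distinct qubits. -/
def Architecture (n R : ℕ) := Fin R → {p : Fin n × Fin n // p.1 ≠ p.2}

/-- Identification of a pair of one-qubit basis indices with a two-qubit basis index. -/
def pairIdx (a b : Fin 2) : Fin 4 := ⟨2 * a.val + b.val, by omega⟩

/-- The `n`-qubit matrix given by letting the two-qubit matrix `u` act on the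
tensor factors `p.1` and `p.2`, and as the identity on all other factors. -/
noncomputable def embedGate {n : ℕ} (p : Fin n × Fin n) (u : Matrix (Fin 4) (Fin 4) ℂ) :
    NMatrix n := fun a b =>
  if (∀ i, i ≠ p.1 → i ≠ p.2 → a i = b i)
  then u (pairIdx (a p.1) (a p.2)) (pairIdx (b p.1) (b p.2)) else 0

/-- The list of `n`-qubit gates obtained by substituting the gates `x` into
the architecture `A`. -/
noncomputable def gateList {n R : ℕ} (A : Architecture n R) (x : Fin R → SU4) :
    List (NMatrix n) :=
  List.ofFn fun i => embedGate (A i).1 (x i : Matrix (Fin 4) (Fin 4) ℂ)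

/-- The contraction map `F^A` of an architecture `A`: it sends a tuple of two-qubit gates
`(u_1, …, u_R)` to the `n`-qubit unitary `(u_R)_{p_R} ⋯ (u_1)_{p_1}`. -/
noncomputable def contract {n R : ℕ} (A : Architecture n R) (x : Fin R → SU4) : NMatrix n :=
  ((gateList A x).reverse).prod

/-- The exact circuit complexity: the least number `R` of two-qubit gates, arranged in any
architecture, implementing the matrix `U`. -/
noncomputable def Cu (n : ℕ) (U : NMatrix n) : ℕ :=
  sInf {R | ∃ A : Architecture n R, ∃ x : Fin R → SU4, contract A x = U}

/-- The all-zeros computational basis state `|0^n⟩`. -/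
noncomputable def ket0 (n : ℕ) : QubitBasis n → ℂ := fun a => if a = fun _ => 0 then 1 else 0

/-- The exact state complexity: the least number `R` of two-qubit gates, arranged in any
architecture, producing `ψ` from `|0^n⟩`. -/
noncomputable def Cstate (n : ℕ) (ψ : QubitBasis n → ℂ) : ℕ :=
  sInf {R | ∃ A : Architecture n R, ∃ x : Fin R → SU4, (contract A x) *ᵥ ket0 n = ψ}

/-- The gates with indices `lo ≤ i < hi` of `A` form a causal slice with sink qubit `t`:
every qubit `q` is connected to `t` by a path through gates of the slice, taken in
increasing index order. -/
def IsCausalSliceWith {n R : ℕ} (A : Architecture n R) (lo hi : ℕ) (t : Fin n) : Prop :=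
  ∀ q : Fin n, ∃ (m : ℕ) (idx : Fin m → Fin R) (qs : Fin (m + 1) → Fin n),
    StrictMono idx ∧ (∀ l, lo ≤ (idx l : ℕ) ∧ (idx l : ℕ) < hi) ∧
    qs 0 = q ∧ qs (Fin.last m) = t ∧
    ∀ l : Fin m,
      (qs l.castSucc = (A (idx l)).1.1 ∨ qs l.castSucc = (A (idx l)).1.2) ∧
      (qs l.succ = (A (idx l)).1.1 ∨ qs l.succ = (A (idx l)).1.2)

/-- The gates with indices `lo ≤ i < hi` of `A` form a causal slice. -/
def IsCausalSlice {n R : ℕ} (A : Architecture n R) (lo hi : ℕ) : Prop :=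
  ∃ t, IsCausalSliceWith A lo hi t

/-! ## Group, topological, measurable and compactness structure on `SU(4)`,
and its Haar probability measure -/

namespace SU4

theorem star_mem {U : Matrix (Fin 4) (Fin 4) ℂ}
    (hU : U ∈ Matrix.specialUnitaryGroup (Fin 4) ℂ) :
    star U ∈ Matrix.specialUnitaryGroup (Fin 4) ℂ := by
  rw [Matrix.mem_specialUnitaryGroup_iff] at hU ⊢
  refine ⟨Unitary.star_mem hU.1, ?_⟩
  have : (star U).det = star U.det := by
    simp [Matrix.star_eq_conjTranspose, Matrix.det_conjTranspose]
  rw [this, hU.2]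
  simp

noncomputable instance : Group SU4 :=
  { (inferInstance : Monoid SU4) with
    inv := fun U => ⟨star U.1, star_mem U.2⟩
    inv_mul_cancel := fun U => Subtype.ext <| by
      have h := (Matrix.mem_specialUnitaryGroup_iff.mp U.2).1.1
      simpa using h }

instance : IsTopologicalGroup SU4 where
  continuous_mul := by
    apply Continuous.subtype_mk
    exact ((continuous_subtype_val.comp continuous_fst).matrix_mul
      (continuous_subtype_val.comp continuous_snd))
  continuous_inv := by
    apply Continuous.subtype_mk
    exact continuous_star.comp continuous_subtype_val

noncomputable instance : MeasurableSpace (Matrix (Fin 4) (Fin 4) ℂ) :=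
  inferInstanceAs (MeasurableSpace (Fin 4 → Fin 4 → ℂ))

instance : BorelSpace (Matrix (Fin 4) (Fin 4) ℂ) :=
  inferInstanceAs (BorelSpace (Fin 4 → Fin 4 → ℂ))

theorem isClosed :
    IsClosed (Matrix.specialUnitaryGroup (Fin 4) ℂ : Set (Matrix (Fin 4) (Fin 4) ℂ)) := by
  have h1 : IsClosed {M : Matrix (Fin 4) (Fin 4) ℂ | star M * M = 1} :=
    isClosed_eq ((continuous_id.matrix_conjTranspose).matrix_mul continuous_id) continuous_const
  have h2 : IsClosed {M : Matrix (Fin 4) (Fin 4) ℂ | M * star M = 1} :=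
    isClosed_eq (continuous_id.matrix_mul (continuous_id.matrix_conjTranspose)) continuous_const
  have h3 : IsClosed {M : Matrix (Fin 4) (Fin 4) ℂ | M.det = 1} :=
    isClosed_eq continuous_id.matrix_det continuous_const
  have : (Matrix.specialUnitaryGroup (Fin 4) ℂ : Set (Matrix (Fin 4) (Fin 4) ℂ)) =
      ({M | star M * M = 1} ∩ {M | M * star M = 1}) ∩ {M | M.det = 1} := by
    ext M
    simp only [SetLike.mem_coe, Matrix.mem_specialUnitaryGroup_iff, Unitary.mem_iff,
      Set.mem_inter_iff, Set.mem_setOf_eq]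
  rw [this]
  exact ((h1.inter h2)).inter h3

theorem isCompact :
    IsCompact (Matrix.specialUnitaryGroup (Fin 4) ℂ : Set (Matrix (Fin 4) (Fin 4) ℂ)) := by
  have hK : IsCompact (Set.pi Set.univ fun _ : Fin 4 => Set.pi Set.univ fun _ : Fin 4 =>
      Metric.closedBall (0 : ℂ) 1 : Set (Matrix (Fin 4) (Fin 4) ℂ)) :=
    isCompact_univ_pi fun _ => isCompact_univ_pi fun _ => isCompact_closedBall _ _
  refine IsCompact.of_isClosed_subset hK isClosed ?_
  intro M hM
  refine fun i _ => fun j _ => ?_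
  simp only [Metric.mem_closedBall, dist_zero_right]
  exact entry_norm_bound_of_unitary (Matrix.mem_specialUnitaryGroup_iff.mp hM).1 i j

instance : CompactSpace SU4 :=
  isCompact_iff_compactSpace.mp isCompact

noncomputable instance : MeasurableSpace SU4 := borel SU4

instance : BorelSpace SU4 := ⟨rfl⟩

end SU4

/-- The Haar probability measure on `SU(4)`. -/
noncomputable def haarSU4 : Measure SU4 :=
  Measure.haarMeasure ⟨⟨Set.univ, isCompact_univ⟩, by simp⟩

instance : IsProbabilityMeasure haarSU4 := by
  constructor
  have h : Measure.haarMeasure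
      (⟨⟨Set.univ, isCompact_univ⟩, by simp⟩ : TopologicalSpace.PositiveCompacts SU4)
      (⟨⟨Set.univ, isCompact_univ⟩, by simp⟩ : TopologicalSpace.PositiveCompacts SU4) = 1 :=
    Measure.haarMeasure_self
  simpa [haarSU4] using h

/-- The product of Haar probability measures on `SU(4)^{×R}`: the distribution of a random
quantum circuit with `R` gates in a fixed architecture. -/
noncomputable def muSU4 (R : ℕ) : Measure (Fin R → SU4) :=
  Measure.pi fun _ => haarSU4

/-! ## The differential of the contraction map, its rank, and the accessible dimension -/

/-- The Lie algebra `su(m)` of traceless skew-Hermitian matrices, as a real subspace. -/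
noncomputable def suAlgebra (m : Type*) [Fintype m] [DecidableEq m] :
    Submodule ℝ (Matrix m m ℂ) :=
  Submodule.span ℝ {H | Hᴴ = -H ∧ H.trace = 0}

/-- `embedGate` as a real-linear map in the gate entry. -/
noncomputable def embedLin {n : ℕ} (p : Fin n × Fin n) :
    Matrix (Fin 4) (Fin 4) ℂ →ₗ[ℝ] NMatrix n where
  toFun := embedGate p
  map_add' u v := by
    funext a b
    simp only [embedGate, Matrix.add_apply]
    split <;> simp
  map_smul' r u := by
    funext a b
    simp only [embedGate, Matrix.smul_apply, RingHom.id_apply]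
    split <;> simp

/-- The differential of the contraction map `F^A` at the point `x ∈ SU(4)^{×R}`, read in the
exponential charts: the direction `(H_1, …, H_R)` is mapped to
`∑_j (U_R)_{p_R} ⋯ (U_{j+1})_{p_{j+1}} · (H_j)_{p_j} · (U_j)_{p_j} ⋯ (U_1)_{p_1}`. -/
noncomputable def contractDiff {n R : ℕ} (A : Architecture n R) (x : Fin R → SU4) :
    (Fin R → Matrix (Fin 4) (Fin 4) ℂ) →ₗ[ℝ] NMatrix n :=
  ∑ j : Fin R,
    (LinearMap.mulLeft ℝ (((gateList A x).drop (j + 1)).reverse.prod)) ∘ₗ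
      (LinearMap.mulRight ℝ
        (embedGate (A j).1 (x j : Matrix (Fin 4) (Fin 4) ℂ) *
          ((gateList A x).take j).reverse.prod)) ∘ₗ
      (embedLin (A j).1) ∘ₗ
      (LinearMap.proj j)

/-- The rank of (the differential of) the contraction map `F^A` at `x`: the dimension of
the image, under the differential, of the tangent space `su(4)^{×R}`. -/
noncomputable def rankAt {n R : ℕ} (A : Architecture n R) (x : Fin R → SU4) : ℕ :=
  Module.finrank ℝ
    ↥(Submodule.map (contractDiff A x) (Submodule.pi Set.univ fun _ => suAlgebra (Fin 4)))

/-- The maximal rank `r_max` of the contraction map `F^A` over all points of `SU(4)^{×R}`. -/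
noncomputable def rmax {n R : ℕ} (A : Architecture n R) : ℕ := ⨆ x, rankAt A x

/-- A matrix viewed as a point of the Euclidean (Frobenius) space of its entries. -/
noncomputable def toEuc {n : ℕ} (M : NMatrix n) :
    EuclideanSpace ℂ (QubitBasis n × QubitBasis n) := WithLp.toLp 2 fun p => M p.1 p.2

/-- The Frobenius norm `‖X‖_F = (tr (X† X))^{1/2}` of an `n`-qubit matrix. -/
noncomputable def frobNorm {n : ℕ} (M : NMatrix n) : ℝ := ‖toEuc M‖

/-- The accessible dimension `d_A` of an architecture `A`: the Hausdorff dimension of the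
set `U(A)` of unitaries implementable with `A`, with respect to the Frobenius metric. -/
noncomputable def accessibleDim {n R : ℕ} (A : Architecture n R) : ℝ≥0∞ :=
  dimH (toEuc '' Set.range (contract A))

/-! ## Pauli strings and Clifford gates -/

/-- The Pauli matrices `1, X, Y, Z`. -/
noncomputable def pauli : Fin 4 → Matrix (Fin 2) (Fin 2) ℂ
  | 0 => 1
  | 1 => !![0, 1; 1, 0]
  | 2 => !![0, -Complex.I; Complex.I, 0]
  | 3 => !![1, 0; 0, -1]

/-- The `n`-qubit Pauli string `⨂ᵢ pauli (s i)`. -/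
noncomputable def pauliString {n : ℕ} (s : Fin n → Fin 4) : NMatrix n :=
  fun a b => ∏ i, pauli (s i) (a i) (b i)

/-- A two-qubit Pauli string, as a `4 × 4` matrix. -/
noncomputable def pauli2 (s : Fin 2 → Fin 4) : Matrix (Fin 4) (Fin 4) ℂ :=
  fun a b =>
    pauli (s 0) ⟨a.val / 2, by have := a.isLt; omega⟩ ⟨b.val / 2, by have := b.isLt; omega⟩ *
    pauli (s 1) ⟨a.val % 2, by have := a.isLt; omega⟩ ⟨b.val % 2, by have := b.isLt; omega⟩

/-- A two-qubit gate is Clifford if it maps every Pauli string to a scalar multiple of a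
Pauli string under conjugation. -/
def IsCliffordGate (u : Matrix (Fin 4) (Fin 4) ℂ) : Prop :=
  ∀ s : Fin 2 → Fin 4, ∃ (c : ℂ) (s' : Fin 2 → Fin 4),
    u * pauli2 s * uᴴ = c • pauli2 s'

/-- Application to the state `|0^n⟩`, `M ↦ M |0^n⟩`, as a real-linear map. -/
noncomputable def mulVecKet0 (n : ℕ) : NMatrix n →ₗ[ℝ] (QubitBasis n → ℂ) where
  toFun M := M *ᵥ ket0 n
  map_add' M N := Matrix.add_mulVec M N (ket0 n)
  map_smul' r M := by
    simp only [RingHom.id_apply]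
    exact Matrix.smul_mulVec r M (ket0 n)

/-- The rank of (the differential of) the map `G^A : x ↦ F^A(x)|0^n⟩` at `x`. -/
noncomputable def stateRankAt {n R : ℕ} (A : Architecture n R) (x : Fin R → SU4) : ℕ :=
  Module.finrank ℝ
    ↥(Submodule.map ((mulVecKet0 n) ∘ₗ contractDiff A x)
      (Submodule.pi Set.univ fun _ => suAlgebra (Fin 4)))

/-! ## Trace norm and operator norm -/

/-- The positive semidefinite square root of a positive semidefinite matrix. -/
noncomputable def Matrix.PosSemidef.sqrt {n 𝕜 : Type*} [Fintype n] [RCLike 𝕜] [DecidableEq n]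
    {A : Matrix n n 𝕜} (hA : A.PosSemidef) : Matrix n n 𝕜 :=
  hA.1.eigenvectorUnitary.1 * Matrix.diagonal ((↑) ∘ Real.sqrt ∘ hA.1.eigenvalues) *
    (star hA.1.eigenvectorUnitary : Matrix n n 𝕜)

/-- The trace norm `‖M‖₁ = tr ((M† M)^{1/2})` of a square complex matrix. -/
noncomputable def traceNorm {m : Type*} [Fintype m] [DecidableEq m] (M : Matrix m m ℂ) : ℝ :=
  ((Matrix.posSemidef_conjTranspose_mul_self M).sqrt.trace).re

/-- The operator norm (largest singular value) of a square complex matrix: the norm of the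
induced operator between Euclidean spaces. -/
noncomputable def opNorm {m : Type*} [Fintype m] [DecidableEq m] (M : Matrix m m ℂ) : ℝ :=
  ‖LinearMap.toContinuousLinearMap (Matrix.toEuclideanLin M)‖

/-! ## The uniform measure on a finite index set -/

/-- The uniform probability measure on `Fin m`. -/
noncomputable def uniformFin (m : ℕ) : Measure (Fin m) :=
  ((m : ℝ≥0∞))⁻¹ • Measure.count

instance (m : ℕ) : IsFiniteMeasure (uniformFin m) := by
  constructor
  rw [uniformFin, Measure.smul_apply, smul_eq_mul, Measure.count_univ,
    ENat.card_eq_coe_fintype_card, Fintype.card_fin, ENat.toENNReal_coe]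
  rcases Nat.eq_zero_or_pos m with h | h
  · simp [h]
  · rw [ENNReal.inv_mul_cancel (by exact_mod_cast h.ne') (by simp)]
    exact ENNReal.one_lt_top

namespace AccDim

noncomputable def Gm {n : ℕ} (p : Fin n × Fin n) (u : Matrix (Fin 4) (Fin 4) ℂ)
    (M : Fin n → Matrix (Fin 2) (Fin 2) ℂ) : NMatrix n := fun a b =>
  u (pairIdx (a p.1) (a p.2)) (pairIdx (b p.1) (b p.2)) *
    ∏ i ∈ (Finset.univ.erase p.1).erase p.2, M i (a i) (b i)

theorem prod_split {n : ℕ} {j k : Fin n} (h : j ≠ k) (f : Fin n → ℂ) :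
    ∏ i, f i = f j * f k * ∏ i ∈ (Finset.univ.erase j).erase k, f i := by
  rw [← Finset.mul_prod_erase Finset.univ f (Finset.mem_univ j),
    ← Finset.mul_prod_erase (Finset.univ.erase j) f (a := k) (by simp [h.symm]), mul_assoc]

theorem sum_split {n : ℕ} {j k : Fin n} (h : j ≠ k) (F : Fin 2 → Fin 2 → ℂ)
    (f : Fin n → Fin 2 → ℂ) :
    ∑ c : Fin n → Fin 2, F (c j) (c k) * ∏ i ∈ (Finset.univ.erase j).erase k, f i (c i) =
      (∑ y, ∑ z, F y z) * ∏ i ∈ (Finset.univ.erase j).erase k, ∑ z, f i z := by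
  have key : ∀ y z : Fin 2, ∑ c : Fin n → Fin 2, (if c j = y then 1 else 0) *
      (if c k = z then 1 else 0) * ∏ i ∈ (Finset.univ.erase j).erase k, f i (c i) =
      ∏ i ∈ (Finset.univ.erase j).erase k, ∑ z, f i z := by
    intro y z
    let f' : Fin n → Fin 2 → ℂ := fun i w => if i = j then (if w = y then 1 else 0) else
      if i = k then (if w = z then 1 else 0) else f i w
    have h1 := (Finset.prod_univ_sum (fun _ : Fin n => (Finset.univ : Finset (Fin 2))) f').symm
    rw [Fintype.piFinset_univ] at h1
    have h2 : ∀ c : Fin n → Fin 2, ∏ i, f' i (c i) = (if c j = y then 1 else 0) *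
      (if c k = z then 1 else 0) * ∏ i ∈ (Finset.univ.erase j).erase k, f i (c i) := by
      intro c
      rw [prod_split h]
      congr 1
      · simp [f', h.symm]
      · apply Finset.prod_congr rfl
        intro i hi
        simp only [Finset.mem_erase] at hi
        simp [f', hi.1, hi.2.1]
    rw [← Finset.sum_congr rfl (fun c _ => h2 c), h1, prod_split h]
    have h3 : ∏ i ∈ (Finset.univ.erase j).erase k, ∑ w, f' i w =
        ∏ i ∈ (Finset.univ.erase j).erase k, ∑ w, f i w := by
      apply Finset.prod_congr rfl
      intro i hi
      simp only [Finset.mem_erase] at hi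
      simp [f', hi.1, hi.2.1]
    rw [h3]
    simp [f', h.symm]
  have h4 : ∀ c : Fin n → Fin 2, F (c j) (c k) * ∏ i ∈ (Finset.univ.erase j).erase k, f i (c i) =
      ∑ y, ∑ z, F y z * ((if c j = y then 1 else 0) *
      (if c k = z then 1 else 0) * ∏ i ∈ (Finset.univ.erase j).erase k, f i (c i)) := by
    intro c
    simp [mul_assoc]
  rw [Finset.sum_congr rfl (fun c _ => h4 c), Finset.sum_comm, Finset.sum_mul]
  refine Finset.sum_congr rfl fun y _ => ?_
  rw [Finset.sum_comm, Finset.sum_mul]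
  refine Finset.sum_congr rfl fun z _ => ?_
  rw [← Finset.mul_sum, key]

theorem Gm_mul {n : ℕ} (p : Fin n × Fin n) (hp : p.1 ≠ p.2) (u v : Matrix (Fin 4) (Fin 4) ℂ)
    (M N : Fin n → Matrix (Fin 2) (Fin 2) ℂ) :
    Gm p u M * Gm p v N = Gm p (u * v) (fun i => M i * N i) := by
  ext a b
  rw [Matrix.mul_apply]
  have := sum_split hp (fun y z => u (pairIdx (a p.1) (a p.2)) (pairIdx y z) *
    v (pairIdx y z) (pairIdx (b p.1) (b p.2))) (fun i z => M i (a i) z * N i z (b i))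
  simp only [Gm]
  have e : ∀ c : QubitBasis n, u (pairIdx (a p.1) (a p.2)) (pairIdx (c p.1) (c p.2)) *
      (∏ i ∈ (Finset.univ.erase p.1).erase p.2, M i (a i) (c i)) *
      (v (pairIdx (c p.1) (c p.2)) (pairIdx (b p.1) (b p.2)) *
      ∏ i ∈ (Finset.univ.erase p.1).erase p.2, N i (c i) (b i)) =
      (u (pairIdx (a p.1) (a p.2)) (pairIdx (c p.1) (c p.2)) *
      v (pairIdx (c p.1) (c p.2)) (pairIdx (b p.1) (b p.2))) *
      ∏ i ∈ (Finset.univ.erase p.1).erase p.2, M i (a i) (c i) * N i (c i) (b i) := by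
    intro c
    rw [Finset.prod_mul_distrib]; ring
  rw [Finset.sum_congr rfl (fun c _ => e c), this]
  congr 1
  rw [Matrix.mul_apply, Fin.sum_univ_four, Fin.sum_univ_two, Fin.sum_univ_two, Fin.sum_univ_two]
  simp only [pairIdx, add_assoc]
  rfl

theorem embed_eq {n : ℕ} (p : Fin n × Fin n) (u : Matrix (Fin 4) (Fin 4) ℂ) :
    embedGate p u = Gm p u (fun _ => 1) := by
  ext a b
  simp only [embedGate, Gm, Matrix.one_apply]
  rw [Finset.prod_ite_zero]
  simp only [Finset.mem_erase, Finset.mem_univ, and_true, Finset.prod_const_one, mul_ite, mul_one,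
    mul_zero]
  congr 1
  apply propext
  constructor
  · intro h i hi; exact h i hi.2 hi.1
  · intro h i h1 h2; exact h i ⟨h2, h1⟩

theorem pauliString_eq {n : ℕ} (p : Fin n × Fin n) (hp : p.1 ≠ p.2) (s : Fin n → Fin 4) :
    pauliString s = Gm p (pauli2 ![s p.1, s p.2]) (fun i => pauli (s i)) := by
  ext a b
  simp only [pauliString, Gm]
  rw [prod_split hp]
  congr 1
  simp only [pauli2, pairIdx, Matrix.cons_val_zero, Matrix.cons_val_one]
  have e1 : ∀ x y : Fin 2, (2 * x.val + y.val) / 2 = x.val := by intro x y; omega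
  have e2 : ∀ x y : Fin 2, (2 * x.val + y.val) % 2 = y.val := by intro x y; omega
  simp only [e1, e2]

theorem embed_mul {n : ℕ} (p : Fin n × Fin n) (hp : p.1 ≠ p.2) (u v : Matrix (Fin 4) (Fin 4) ℂ) :
    embedGate p u * embedGate p v = embedGate p (u * v) := by
  simp only [embed_eq, Gm_mul p hp, mul_one]

theorem embed_one {n : ℕ} (p : Fin n × Fin n) (hp : p.1 ≠ p.2) :
    embedGate p (1 : Matrix (Fin 4) (Fin 4) ℂ) = 1 := by
  ext a b
  simp only [embedGate, Matrix.one_apply]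
  have e : (pairIdx (a p.1) (a p.2) = pairIdx (b p.1) (b p.2)) ↔
    (a p.1 = b p.1 ∧ a p.2 = b p.2) := by
    simp only [pairIdx, Fin.ext_iff]; omega
  rw [← ite_and]
  congr 1
  apply propext
  rw [e]
  constructor
  · rintro ⟨h, h1, h2⟩
    funext i
    by_cases i1 : i = p.1
    · rw [i1, h1]
    by_cases i2 : i = p.2
    · rw [i2, h2]
    exact h i i1 i2
  · rintro rfl; simp

/-- conjugation moves Pauli strings -/
theorem embed_comm {n : ℕ} (p : Fin n × Fin n) (hp : p.1 ≠ p.2) (u : Matrix (Fin 4) (Fin 4) ℂ)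
    (s s' : Fin n → Fin 4) (hs : ∀ i, i ≠ p.1 → i ≠ p.2 → s i = s' i)
    (hu : u * pauli2 ![s p.1, s p.2] = pauli2 ![s' p.1, s' p.2] * u) :
    embedGate p u * pauliString s = pauliString s' * embedGate p u := by
  rw [embed_eq, pauliString_eq p hp s, pauliString_eq p hp s', Gm_mul p hp, Gm_mul p hp, hu]
  ext a b
  simp only [Gm, one_mul, mul_one]
  congr 1
  apply Finset.prod_congr rfl
  intro i hi
  simp only [Finset.mem_erase] at hi
  rw [hs i hi.2.1 hi.1]

theorem pauliString_eq_embed {n : ℕ} (p : Fin n × Fin n) (hp : p.1 ≠ p.2) (s : Fin n → Fin 4)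
    (hs : ∀ i, s i ≠ 0 → i = p.1 ∨ i = p.2) :
    pauliString s = embedGate p (pauli2 ![s p.1, s p.2]) := by
  rw [pauliString_eq p hp, embed_eq]
  ext a b
  simp only [Gm]
  congr 1
  apply Finset.prod_congr rfl
  intro i hi
  simp only [Finset.mem_erase] at hi
  have : s i = 0 := by
    by_contra h
    rcases hs i h with h | h
    · exact hi.2.1 h
    · exact hi.1 h
  rw [this]; rfl

/-! Paulis -/

theorem trace_pauli_mul (a b : Fin 4) : (pauli a * pauli b).trace = if a = b then 2 else 0 := by
  fin_cases a <;> fin_cases b <;>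
    simp [pauli, Matrix.trace, Fin.sum_univ_two, Matrix.mul_apply, Matrix.one_apply] <;> norm_num

theorem trace_pauliString_mul {n : ℕ} (s t : Fin n → Fin 4) :
    (pauliString s * pauliString t).trace = if s = t then 2 ^ n else 0 := by
  have h : (pauliString s * pauliString t).trace = ∏ i, (pauli (s i) * pauli (t i)).trace := by
    simp only [Matrix.trace, Matrix.diag, Matrix.mul_apply, pauliString, ← Finset.prod_mul_distrib]
    have h1 := fun a : QubitBasis n => (Finset.prod_univ_sum
      (fun _ : Fin n => (Finset.univ : Finset (Fin 2)))
      (fun i c => pauli (s i) (a i) c * pauli (t i) c (a i)))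
    simp only [Fintype.piFinset_univ] at h1
    rw [Finset.sum_congr rfl (fun a _ => (h1 a).symm)]
    have h2 := (Finset.prod_univ_sum
      (fun _ : Fin n => (Finset.univ : Finset (Fin 2)))
      (fun i d => ∑ c, pauli (s i) d c * pauli (t i) c d))
    simp only [Fintype.piFinset_univ] at h2
    rw [h2]
  rw [h]
  simp only [trace_pauli_mul]
  rw [Finset.prod_ite_zero]
  simp [funext_iff]

theorem pauli_linearIndependent (n : ℕ) :
    LinearIndependent ℂ (fun s : Fin n → Fin 4 => pauliString s) := by
  rw [Fintype.linearIndependent_iff]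
  intro g hg t
  have h := congrArg (fun M : NMatrix n => (M * pauliString t).trace) hg
  simp only [Finset.sum_mul, Matrix.trace_sum, Matrix.smul_mul, Matrix.trace_smul,
    trace_pauliString_mul, zero_mul, Matrix.trace_zero] at h
  simpa using h

/-! SU(4) conjugacy -/

theorem exists_phase (u : Matrix (Fin 4) (Fin 4) ℂ) (hu : star u * u = 1) :
    ∃ c : ℂ, c ≠ 0 ∧ c • u ∈ Matrix.specialUnitaryGroup (Fin 4) ℂ := by
  have hdet : star u.det * u.det = 1 := by
    have := congrArg Matrix.det hu
    rwa [Matrix.det_mul, Matrix.star_eq_conjTranspose, Matrix.det_conjTranspose,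
      Matrix.det_one] at this
  have hn : ‖u.det‖ = 1 := by
    have := congrArg norm hdet
    rw [norm_mul, norm_star, norm_one] at this
    nlinarith [norm_nonneg u.det]
  have hd0 : u.det ≠ 0 := by intro h; simp [h] at hn
  obtain ⟨c, hc⟩ := IsAlgClosed.exists_pow_nat_eq (u.det)⁻¹ (n := 4) (by norm_num)
  have hcn : ‖c‖ = 1 := by
    have := congrArg norm hc
    rw [norm_pow, norm_inv, hn, inv_one] at this
    exact (pow_eq_one_iff_of_nonneg (norm_nonneg c) (by norm_num)).1 this
  have hcc : star c * c = 1 := by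
    have := Complex.conj_mul' c
    rw [hcn] at this
    simpa using this
  refine ⟨c, by intro h; simp [h] at hcn, ?_⟩
  rw [Matrix.mem_specialUnitaryGroup_iff, Matrix.mem_unitaryGroup_iff']
  constructor
  · rw [star_smul, Matrix.smul_mul, Matrix.mul_smul, hu, smul_smul, hcc, one_smul]
  · rw [Matrix.det_smul, Fintype.card_fin, hc, inv_mul_cancel₀ hd0]

def Conj (M N : Matrix (Fin 4) (Fin 4) ℂ) : Prop :=
  ∃ u : SU4, (u : Matrix (Fin 4) (Fin 4) ℂ) * M = N * (u : Matrix (Fin 4) (Fin 4) ℂ)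

theorem Conj.trans {M N K : Matrix (Fin 4) (Fin 4) ℂ} (h1 : Conj M N) (h2 : Conj N K) :
    Conj M K := by
  obtain ⟨u, hu⟩ := h1
  obtain ⟨v, hv⟩ := h2
  refine ⟨v * u, ?_⟩
  push_cast
  rw [mul_assoc, hu, ← mul_assoc, hv, mul_assoc]

theorem conj_of_anti {M N : Matrix (Fin 4) (Fin 4) ℂ} (hM : star M = M) (hN : star N = N)
    (hM2 : M * M = 1) (hN2 : N * N = 1) (h : M * N = - (N * M)) : Conj M N := by
  have hr : ((Real.sqrt 2 : ℝ) : ℂ)⁻¹ * ((Real.sqrt 2 : ℝ) : ℂ)⁻¹ = 2⁻¹ := by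
    rw [← mul_inv, ← Complex.ofReal_mul, Real.mul_self_sqrt (by norm_num)]; simp
  obtain ⟨c, -, hc⟩ := exists_phase ((((Real.sqrt 2 : ℝ) : ℂ)⁻¹) • (M + N)) (by
    rw [star_smul, star_add, hM, hN, Matrix.smul_mul, Matrix.mul_smul, smul_smul]
    have : (M + N) * (M + N) = (2 : ℂ) • 1 := by
      rw [mul_add, add_mul, add_mul, hM2, hN2, h, two_smul]; abel
    rw [this]
    have h2 : star (((Real.sqrt 2 : ℝ) : ℂ)⁻¹) = (((Real.sqrt 2 : ℝ) : ℂ)⁻¹) := by simp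
    rw [h2, hr, smul_smul]; simp)
  refine ⟨⟨_, hc⟩, ?_⟩
  simp only [Matrix.smul_mul, Matrix.mul_smul]
  rw [add_mul, mul_add, hM2, hN2, add_comm]

def sgn (a b : Fin 4) : ℤ := if a = 0 ∨ b = 0 ∨ a = b then 1 else -1

theorem pauli_comm (a b : Fin 4) : pauli a * pauli b = (sgn a b : ℂ) • (pauli b * pauli a) := by
  fin_cases a <;> fin_cases b <;> ext i j <;> fin_cases i <;> fin_cases j <;>
    simp [pauli, sgn, Matrix.mul_apply, Fin.sum_univ_two, Matrix.one_apply]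

theorem pauli_sq (a : Fin 4) : pauli a * pauli a = 1 := by
  fin_cases a <;> ext i j <;> fin_cases i <;> fin_cases j <;>
    simp [pauli, Matrix.mul_apply, Fin.sum_univ_two, Matrix.one_apply]

theorem pauli_star (a : Fin 4) (i j : Fin 2) : star (pauli a j i) = pauli a i j := by
  fin_cases a <;> fin_cases i <;> fin_cases j <;> simp [pauli, Matrix.one_apply]

theorem pauli2_mul (s t : Fin 2 → Fin 4) : pauli2 s * pauli2 t = fun a b =>
    (pauli (s 0) * pauli (t 0)) ⟨a.val / 2, by have := a.isLt; omega⟩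
      ⟨b.val / 2, by have := b.isLt; omega⟩ *
    (pauli (s 1) * pauli (t 1)) ⟨a.val % 2, by have := a.isLt; omega⟩
      ⟨b.val % 2, by have := b.isLt; omega⟩ := by
  ext a b
  rw [Matrix.mul_apply, Fin.sum_univ_four]
  simp only [Matrix.mul_apply, Fin.sum_univ_two, pauli2]
  have h0 : (⟨0, by norm_num⟩ : Fin 2) = 0 := rfl
  have h1 : (⟨1, by norm_num⟩ : Fin 2) = 1 := rfl
  simp [h0, h1]
  ring

theorem pauli2_sq (s : Fin 2 → Fin 4) : pauli2 s * pauli2 s = 1 := by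
  rw [pauli2_mul]
  ext a b
  simp only [pauli_sq]
  fin_cases a <;> fin_cases b <;> simp [Matrix.one_apply]

theorem pauli2_star (s : Fin 2 → Fin 4) : star (pauli2 s) = pauli2 s := by
  ext a b
  rw [Matrix.star_apply]
  simp only [pauli2]
  rw [star_mul, pauli_star, pauli_star, mul_comm]

theorem pauli2_comm (s t : Fin 2 → Fin 4) :
    pauli2 s * pauli2 t = ((sgn (s 0) (t 0) * sgn (s 1) (t 1) : ℤ) : ℂ) • (pauli2 t * pauli2 s) := by
  rw [pauli2_mul, pauli2_mul, pauli_comm (s 0), pauli_comm (s 1)]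
  ext a b
  simp only [Matrix.smul_apply, smul_eq_mul]
  change _ = ((sgn (s 0) (t 0) * sgn (s 1) (t 1) : ℤ) : ℂ) * (_ * _)
  push_cast
  ring

theorem conj_of_sgn (s t : Fin 2 → Fin 4) (h : sgn (s 0) (t 0) * sgn (s 1) (t 1) = -1) :
    Conj (pauli2 s) (pauli2 t) := by
  apply conj_of_anti (pauli2_star s) (pauli2_star t) (pauli2_sq s) (pauli2_sq t)
  rw [pauli2_comm, h]; simp

theorem conj_pauli (a b c d : Fin 4) (h : ¬ (a = 0 ∧ b = 0)) (h' : ¬ (c = 0 ∧ d = 0)) :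
    Conj (pauli2 ![a, b]) (pauli2 ![c, d]) := by
  have key : ∀ a b c d : Fin 4, ¬ (a = 0 ∧ b = 0) → ¬ (c = 0 ∧ d = 0) →
      ∃ e f, sgn a e * sgn b f = -1 ∧ sgn e c * sgn f d = -1 := by decide
  obtain ⟨e, f, h1, h2⟩ := key a b c d h h'
  exact (conj_of_sgn ![a, b] ![e, f] (by simpa using h1)).trans
    (conj_of_sgn ![e, f] ![c, d] (by simpa using h2))

end AccDim

namespace AccDim
open scoped Matrix.Norms.Operator

abbrev QPair (n : ℕ) := {p : Fin n × Fin n // p.1 ≠ p.2}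

/-- matrices implementable by a list of gates (first gate acts first) -/
def RS {n : ℕ} : List (QPair n) → Set (NMatrix n)
  | [] => {1}
  | p :: l => {M | ∃ V ∈ RS l, ∃ u : SU4, M = V * embedGate p.1 (u : Matrix (Fin 4) (Fin 4) ℂ)}

def Reach {n : ℕ} (t : Fin n) : List (QPair n) → Set (Fin n)
  | [] => {t}
  | p :: l => {q | q ∈ Reach t l ∨
      ((p.1.1 ∈ Reach t l ∨ p.1.2 ∈ Reach t l) ∧ (q = p.1.1 ∨ q = p.1.2))}

theorem RS_one {n : ℕ} (l : List (QPair n)) : (1 : NMatrix n) ∈ RS l := by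
  induction l with
  | nil => simp [RS]
  | cons p l ih => exact ⟨1, ih, 1, by simp [embed_one p.1 p.2]⟩

theorem RS_append {n : ℕ} (l l' : List (QPair n)) {V W : NMatrix n} (hV : V ∈ RS l)
    (hW : W ∈ RS l') : W * V ∈ RS (l ++ l') := by
  induction l generalizing V with
  | nil =>
    have : V = 1 := by simpa [RS] using hV
    simpa [this] using hW
  | cons p l ih =>
    obtain ⟨V', hV', u, rfl⟩ := hV
    exact ⟨W * V', ih hV', u, by rw [mul_assoc]⟩

theorem su_star (u : SU4) : star (u : Matrix (Fin 4) (Fin 4) ℂ) * u = 1 :=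
  (Matrix.mem_specialUnitaryGroup_iff.mp u.2).1.1

theorem su_star' (u : SU4) : (u : Matrix (Fin 4) (Fin 4) ℂ) * star (u : Matrix (Fin 4) (Fin 4) ℂ) = 1 :=
  (Matrix.mem_specialUnitaryGroup_iff.mp u.2).1.2

theorem embed_isUnit {n : ℕ} (p : QPair n) (u : SU4) :
    IsUnit (embedGate p.1 (u : Matrix (Fin 4) (Fin 4) ℂ)) := by
  refine IsUnit.of_mul_eq_one (embedGate p.1 (star (u : Matrix (Fin 4) (Fin 4) ℂ))) ?_
  rw [embed_mul p.1 p.2, su_star', embed_one p.1 p.2]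

theorem RS_isUnit {n : ℕ} (l : List (QPair n)) {V : NMatrix n} (hV : V ∈ RS l) : IsUnit V := by
  induction l generalizing V with
  | nil =>
    have : V = 1 := by simpa [RS] using hV
    simp [this]
  | cons p l ih =>
    obtain ⟨V', hV', u, rfl⟩ := hV
    exact (ih hV').mul (embed_isUnit p u)

theorem mem_Reach_self {n : ℕ} (t : Fin n) (l : List (QPair n)) : t ∈ Reach t l := by
  induction l with
  | nil => simp [Reach]
  | cons p l ih => exact Or.inl ih

theorem Reach_append {n : ℕ} (t : Fin n) (l l' : List (QPair n)) : Reach t l' ⊆ Reach t (l ++ l') := by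
  induction l with
  | nil => simp
  | cons p l ih => exact fun q hq => Or.inl (ih hq)

theorem Reach_of_not_touch {n : ℕ} (t : Fin n) (l : List (QPair n))
    (h : ¬ ∃ p ∈ l, p.1.1 = t ∨ p.1.2 = t) : Reach t l = {t} := by
  induction l with
  | nil => simp [Reach]
  | cons p l ih =>
    have h1 := ih (fun ⟨p', hp', h'⟩ => h ⟨p', List.mem_cons_of_mem _ hp', h'⟩)
    have h2 : ¬ (p.1.1 = t ∨ p.1.2 = t) := fun h' => h ⟨p, List.mem_cons_self, h'⟩
    ext q
    simp only [Reach, h1, Set.mem_singleton_iff]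
    constructor
    · rintro (h | ⟨h, -⟩)
      · exact h
      · exact absurd h h2
    · exact Or.inl

theorem step_gate {n : ℕ} (p : QPair n) (S : Set (Fin n)) (s : Fin n → Fin 4) (hs0 : s ≠ 0)
    (hs : ∀ q, s q ≠ 0 → q ∈ S ∨ ((p.1.1 ∈ S ∨ p.1.2 ∈ S) ∧ (q = p.1.1 ∨ q = p.1.2))) :
    ∃ (u : SU4) (s' : Fin n → Fin 4), s' ≠ 0 ∧ (∀ q, s' q ≠ 0 → q ∈ S) ∧
      embedGate p.1 (u : Matrix (Fin 4) (Fin 4) ℂ) * pauliString s =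
        pauliString s' * embedGate p.1 (u : Matrix (Fin 4) (Fin 4) ℂ) := by
  have hp := p.2
  by_cases hS : p.1.1 ∈ S ∨ p.1.2 ∈ S
  swap
  · refine ⟨1, s, hs0, fun q hq => ?_, by simp [embed_one p.1 p.2]⟩
    rcases hs q hq with h | h
    · exact h
    · exact absurd h.1 hS
  by_cases h00 : s p.1.1 = 0 ∧ s p.1.2 = 0
  · refine ⟨1, s, hs0, fun q hq => ?_, by simp [embed_one p.1 p.2]⟩
    rcases hs q hq with h | ⟨-, h | h⟩
    · exact h
    · exact absurd (h ▸ h00.1) hq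
    · exact absurd (h ▸ h00.2) hq
  have main : ∀ c d : Fin 4, ¬ (c = 0 ∧ d = 0) → (c ≠ 0 → p.1.1 ∈ S) → (d ≠ 0 → p.1.2 ∈ S) →
    ∃ (u : SU4) (s' : Fin n → Fin 4), s' ≠ 0 ∧ (∀ q, s' q ≠ 0 → q ∈ S) ∧
      embedGate p.1 (u : Matrix (Fin 4) (Fin 4) ℂ) * pauliString s =
        pauliString s' * embedGate p.1 (u : Matrix (Fin 4) (Fin 4) ℂ) := by
    intro c d hcd hc hd
    obtain ⟨u, hu⟩ := conj_pauli (s p.1.1) (s p.1.2) c d h00 hcd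
    let s' : Fin n → Fin 4 := fun i => if i = p.1.1 then c else if i = p.1.2 then d else s i
    have h1 : s' p.1.1 = c := by simp [s']
    have h2 : s' p.1.2 = d := by simp [s', hp.symm]
    refine ⟨u, s', ?_, ?_, embed_comm p.1 hp u s s' ?_ ?_⟩
    · intro h
      apply hcd
      rw [← h1, ← h2, h]; simp
    · intro q hq
      by_cases e1 : q = p.1.1
      · rw [e1]; apply hc; rwa [e1, h1] at hq
      by_cases e2 : q = p.1.2
      · rw [e2]; apply hd; rwa [e2, h2] at hq
      have : s' q = s q := by simp [s', e1, e2]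
      rw [this] at hq
      rcases hs q hq with h | ⟨-, h | h⟩
      · exact h
      · exact absurd h e1
      · exact absurd h e2
    · intro i e1 e2
      simp [s', e1, e2]
    · rw [h1, h2]; exact hu
  rcases hS with hS | hS
  · exact main 3 0 (by decide) (fun _ => hS) (fun h => absurd rfl h)
  · exact main 0 3 (by decide) (fun h => absurd rfl h) (fun _ => hS)

noncomputable def rotM (θ : ℝ) : Matrix (Fin 4) (Fin 4) ℂ :=
  (Real.cos θ : ℂ) • 1 + (Real.sin θ : ℂ) • (Complex.I • pauli2 ![3, 0])

theorem rotM_mem (θ : ℝ) : rotM θ ∈ Matrix.specialUnitaryGroup (Fin 4) ℂ := by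
  have hcs : (Real.cos θ : ℂ) * Real.cos θ + Real.sin θ * Real.sin θ = 1 := by
    have := Real.cos_sq_add_sin_sq θ
    rw [← Complex.ofReal_mul, ← Complex.ofReal_mul, ← Complex.ofReal_add, ← sq, ← sq, this]; simp
  have hd : rotM θ = Matrix.diagonal ![(Real.cos θ : ℂ) + Real.sin θ * Complex.I,
      (Real.cos θ : ℂ) + Real.sin θ * Complex.I, (Real.cos θ : ℂ) - Real.sin θ * Complex.I,
      (Real.cos θ : ℂ) - Real.sin θ * Complex.I] := by
    ext a b
    fin_cases a <;> fin_cases b <;>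
      simp [rotM, pauli2, pauli, Matrix.one_apply, sub_eq_add_neg, -Complex.ofReal_cos, -Complex.ofReal_sin]
  have hI := Complex.I_mul_I
  rw [Matrix.mem_specialUnitaryGroup_iff, Matrix.mem_unitaryGroup_iff']
  constructor
  · rw [hd, Matrix.star_eq_conjTranspose, Matrix.diagonal_conjTranspose, Matrix.diagonal_mul_diagonal,
      ← Matrix.diagonal_one]
    congr 1
    funext i
    fin_cases i <;> simp [-Complex.ofReal_cos, -Complex.ofReal_sin] <;>
      linear_combination hcs - (Real.sin θ : ℂ) * Real.sin θ * hI
  · rw [hd, Matrix.det_diagonal, Fin.prod_univ_four]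
    simp [-Complex.ofReal_cos, -Complex.ofReal_sin]
    have : ((Real.cos θ : ℂ) + Real.sin θ * Complex.I) * ((Real.cos θ : ℂ) - Real.sin θ * Complex.I) = 1 := by
      linear_combination hcs - (Real.sin θ : ℂ) * Real.sin θ * hI
    linear_combination (((Real.cos θ : ℂ) + Real.sin θ * Complex.I) * ((Real.cos θ : ℂ) - Real.sin θ * Complex.I) + 1) * this

theorem embed_smul {n : ℕ} (p : Fin n × Fin n) (c : ℂ) (u : Matrix (Fin 4) (Fin 4) ℂ) :
    embedGate p (c • u) = c • embedGate p u := by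
  ext a b
  simp only [embedGate, Matrix.smul_apply]
  split <;> simp

theorem embed_add {n : ℕ} (p : Fin n × Fin n) (u v : Matrix (Fin 4) (Fin 4) ℂ) :
    embedGate p (u + v) = embedGate p u + embedGate p v := (embedLin p).map_add u v

theorem slice_curve {n : ℕ} (t : Fin n) (l : List (QPair n))
    (ht : ∃ p ∈ l, p.1.1 = t ∨ p.1.2 = t) (s : Fin n → Fin 4) (hs0 : s ≠ 0)
    (hs : ∀ q, s q ≠ 0 → q ∈ Reach t l) :
    ∃ γ : ℝ → NMatrix n, (∀ θ, γ θ ∈ RS l) ∧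
      HasStrictDerivAt γ (γ 0 * (Complex.I • pauliString s)) 0 := by
  induction l generalizing s with
  | nil => simp at ht
  | cons p l ih =>
    by_cases hl : ∃ p ∈ l, p.1.1 = t ∨ p.1.2 = t
    · obtain ⟨u, s', hs'0, hs', hu⟩ := step_gate p (Reach t l) s hs0 hs
      obtain ⟨γ, hγ, hd⟩ := ih hl s' hs'0 hs'
      refine ⟨fun θ => γ θ * embedGate p.1 (u : Matrix (Fin 4) (Fin 4) ℂ),
        fun θ => ⟨γ θ, hγ θ, u, rfl⟩, ?_⟩
      have := hd.mul_const (embedGate p.1 (u : Matrix (Fin 4) (Fin 4) ℂ))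
      have e : γ 0 * embedGate p.1 (u : Matrix (Fin 4) (Fin 4) ℂ) * (Complex.I • pauliString s) =
          γ 0 * (Complex.I • pauliString s') * embedGate p.1 (u : Matrix (Fin 4) (Fin 4) ℂ) := by
        rw [mul_assoc, mul_assoc, Matrix.mul_smul, hu, Matrix.smul_mul]
      exact e ▸ this
    · have hR := Reach_of_not_touch t l hl
      have hpt : p.1.1 = t ∨ p.1.2 = t := by
        obtain ⟨p', hp', h⟩ := ht
        rcases List.mem_cons.1 hp' with h' | h'
        · exact h' ▸ h
        · exact absurd ⟨p', h', h⟩ hl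
      have hsupp : ∀ i, s i ≠ 0 → i = p.1.1 ∨ i = p.1.2 := by
        intro i hi
        have := hs i hi
        simp only [Reach, hR] at this
        rcases this with h | ⟨-, h⟩
        · have : i = t := h
          rcases hpt with h' | h'
          · left; rw [this, h']
          · right; rw [this, h']
        · exact h
      have h00 : ¬ (s p.1.1 = 0 ∧ s p.1.2 = 0) := by
        rintro ⟨h1, h2⟩
        apply hs0
        funext i
        by_contra hi
        rcases hsupp i hi with h | h
        · exact hi (h ▸ h1)
        · exact hi (h ▸ h2)
      obtain ⟨u, hu⟩ := conj_pauli (s p.1.1) (s p.1.2) 3 0 h00 (by decide)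
      have hu' : star (u : Matrix (Fin 4) (Fin 4) ℂ) * (pauli2 ![3, 0] * u) =
          pauli2 ![s p.1.1, s p.1.2] := by
        rw [← hu, ← mul_assoc, su_star, one_mul]
      have hform : ∀ θ : ℝ, star (u : Matrix (Fin 4) (Fin 4) ℂ) * (rotM θ * u) =
          (Real.cos θ : ℂ) • 1 + (Real.sin θ : ℂ) • (Complex.I • pauli2 ![s p.1.1, s p.1.2]) := by
        intro θ
        rw [rotM, add_mul, mul_add]
        simp only [Matrix.smul_mul, Matrix.mul_smul, one_mul, su_star, hu']
      have hγ : ∀ θ : ℝ, embedGate p.1 (star (u : Matrix (Fin 4) (Fin 4) ℂ) * (rotM θ * u)) =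
          Real.cos θ • (1 : NMatrix n) + Real.sin θ • (Complex.I • pauliString s) := by
        intro θ
        rw [hform, embed_add, embed_smul, embed_smul, embed_smul, embed_one p.1 p.2,
          ← pauliString_eq_embed p.1 p.2 s hsupp]
        rfl
      refine ⟨fun θ => embedGate p.1 (star (u : Matrix (Fin 4) (Fin 4) ℂ) * (rotM θ * u)),
        fun θ => ⟨1, RS_one l, u⁻¹ * (⟨rotM θ, rotM_mem θ⟩ * u), ?_⟩, ?_⟩
      · rw [one_mul]; rfl
      · simp only [hγ]
        have h1 := ((Real.hasStrictDerivAt_cos 0).smul_const (1 : NMatrix n)).add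
          ((Real.hasStrictDerivAt_sin 0).smul_const (Complex.I • pauliString s))
        have e : (Real.cos 0 • (1 : NMatrix n) + Real.sin 0 • (Complex.I • pauliString s)) *
            (Complex.I • pauliString s) =
            -Real.sin 0 • (1 : NMatrix n) + Real.cos 0 • (Complex.I • pauliString s) := by
          simp
        exact e ▸ h1

end AccDim

namespace AccDim
open scoped Matrix.Norms.Operator

theorem exists_pauli_notMem {n : ℕ} (W : Submodule ℝ (NMatrix n)) (g : NMatrix n) (hg : IsUnit g)
    (hW : Module.finrank ℝ W < 4 ^ n - 1) :
    ∃ s : Fin n → Fin 4, s ≠ 0 ∧ (Complex.I • pauliString s) * g ∉ W := by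
  by_contra hcon
  push Not at hcon
  have li0 : LinearIndependent ℝ (fun s : Fin n → Fin 4 => pauliString s) :=
    (pauli_linearIndependent n).restrict_scalars' ℝ
  let φ : NMatrix n →ₗ[ℝ] NMatrix n :=
    { toFun := fun M => (Complex.I • M) * g
      map_add' := fun M N => by rw [smul_add, add_mul]
      map_smul' := fun r M => by
        rw [smul_comm, RingHom.id_apply, smul_mul_assoc] }
  have hφ : LinearMap.ker φ = ⊥ := by
    rw [LinearMap.ker_eq_bot']
    intro M hM
    have h1 : (Complex.I • M) * g = 0 := hM
    rw [hg.mul_left_eq_zero] at h1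
    exact (smul_eq_zero.1 h1).resolve_left Complex.I_ne_zero
  have li1 := li0.map' φ hφ
  have li2 := li1.comp (Subtype.val : {s : Fin n → Fin 4 // s ≠ 0} → _) Subtype.val_injective
  have li3 : LinearIndependent ℝ (fun s : {s : Fin n → Fin 4 // s ≠ 0} =>
      (⟨(Complex.I • pauliString s.1) * g, hcon s.1 s.2⟩ : W)) := by
    apply LinearIndependent.of_comp W.subtype
    exact li2
  have h := li3.fintype_card_le_finrank
  rw [Fintype.card_subtype_compl] at h
  simp at h
  omega

theorem aux_alg {B : Type*} [Ring B] [Algebra ℝ B] (G P g d1 d2 : B) (a b : ℝ)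
    (h : G * d1 + (a • (G * P)) * g = G * d2 + (b • (G * P)) * g) :
    G * ((d1 - d2) + (a - b) • (P * g)) = 0 := by
  have h' := sub_eq_zero.2 h
  rw [← h', mul_add, mul_sub, sub_smul, mul_sub,
    mul_smul_comm, mul_smul_comm, smul_mul_assoc, smul_mul_assoc, mul_assoc]
  abel

theorem main_curve {n : ℕ} (hn : 2 ≤ n) (L : ℕ) (l : List (QPair n)) (T : ℕ)
    (hT : T ≤ 4 ^ n - 1)
    (hl : ∀ s < T, ∃ t, ∀ q, q ∈ Reach t ((l.drop (s * L)).take L)) :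
    ∃ (g : (Fin T → ℝ) → NMatrix n) (D : (Fin T → ℝ) →L[ℝ] NMatrix n),
      (∀ θ, g θ ∈ RS (l.take (T * L))) ∧ HasStrictFDerivAt g D 0 ∧ Function.Injective D := by
  induction T with
  | zero =>
    refine ⟨fun _ => 1, 0, fun _ => RS_one _, hasStrictFDerivAt_const _ _, ?_⟩
    intro a b _
    exact Subsingleton.elim _ _
  | succ T ih =>
    obtain ⟨g, D, hg, hD, hinj⟩ := ih (by omega) (fun s hs => hl s (by omega))
    obtain ⟨t, ht⟩ := hl T (by omega)
    have hrank : Module.finrank ℝ (LinearMap.range (D : (Fin T → ℝ) →ₗ[ℝ] NMatrix n)) <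
        4 ^ n - 1 := by
      have := LinearMap.finrank_range_le (D : (Fin T → ℝ) →ₗ[ℝ] NMatrix n)
      simp at this
      simp
      omega
    obtain ⟨s, hs0, hs⟩ := exists_pauli_notMem _ (g 0) (RS_isUnit _ (hg 0)) hrank
    have htouch : ∃ p ∈ (l.drop (T * L)).take L, p.1.1 = t ∨ p.1.2 = t := by
      by_contra h
      have hR := Reach_of_not_touch t _ h
      have : Nontrivial (Fin n) := Fin.nontrivial_iff_two_le.2 hn
      obtain ⟨q, hq⟩ := exists_ne t
      have := ht q
      rw [hR] at this
      exact hq this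
    obtain ⟨γ, hγ, hγd⟩ := slice_curve t _ htouch s hs0 (fun q _ => ht q)
    let pr : (Fin (T + 1) → ℝ) →L[ℝ] (Fin T → ℝ) :=
      ContinuousLinearMap.pi fun i => ContinuousLinearMap.proj i.castSucc
    let la : (Fin (T + 1) → ℝ) →L[ℝ] ℝ := ContinuousLinearMap.proj (Fin.last T)
    have h1 : HasStrictFDerivAt (fun θ => g (pr θ)) (D.comp pr) 0 := by
      have h0 : HasStrictFDerivAt g D (pr 0) := by rw [map_zero]; exact hD
      exact h0.comp 0 pr.hasStrictFDerivAt
    have h2 : HasStrictFDerivAt (fun θ => γ (la θ)) ((ContinuousLinearMap.toSpanSingleton ℝ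
        (γ 0 * (Complex.I • pauliString s))).comp la) 0 := by
      have h0 : HasStrictFDerivAt γ (ContinuousLinearMap.toSpanSingleton ℝ
        (γ 0 * (Complex.I • pauliString s))) (la 0) := by
        rw [map_zero]; exact hγd.hasStrictFDerivAt
      exact h0.comp 0 la.hasStrictFDerivAt
    have h3 := h2.mul' h1
    refine ⟨_, _, ?_, h3, ?_⟩
    · intro θ
      have := RS_append _ _ (hg (pr θ)) (hγ (la θ))
      rw [← List.take_add] at this
      rw [add_mul, one_mul]
      exact this
    · intro a b hab
      have hab' : γ (la 0) * D (pr a) + (la a • (γ 0 * (Complex.I • pauliString s))) * g (pr 0) =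
        γ (la 0) * D (pr b) + (la b • (γ 0 * (Complex.I • pauliString s))) * g (pr 0) := hab
      rw [map_zero, map_zero] at hab'
      rw [← sub_eq_zero]
      generalize hθ : a - b = θ
      have e : γ 0 * (D (pr θ) + (la θ) • ((Complex.I • pauliString s) * g 0)) = 0 := by
        rw [← hθ, map_sub, map_sub, map_sub]
        exact aux_alg _ _ _ _ _ _ _ hab'
      rw [(RS_isUnit _ (hγ 0)).mul_right_eq_zero] at e
      have hla : la θ = 0 := by
        by_contra hne
        apply hs
        refine ⟨(-(la θ)⁻¹) • pr θ, ?_⟩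
        have : D (pr θ) = - ((la θ) • ((Complex.I • pauliString s) * g 0)) :=
          eq_neg_of_add_eq_zero_left e
        change D _ = _
        rw [map_smul, this, smul_neg, neg_smul, neg_neg, smul_smul, inv_mul_cancel₀ hne, one_smul]
      rw [hla, zero_smul, add_zero] at e
      have hpr : pr θ = 0 := hinj (by rw [e, map_zero])
      funext i
      refine Fin.lastCases ?_ (fun j => ?_) i
      · exact hla
      · exact congrFun hpr j

def arch {n R : ℕ} (A : Architecture n R) : Fin R → QPair n := A

theorem reach_of_path {n R : ℕ} (A : Architecture n R) (hi : ℕ) (t : Fin n) (m : ℕ) :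
    ∀ (lo : ℕ) (idx : Fin m → Fin R) (qs : Fin (m + 1) → Fin n),
    StrictMono idx → (∀ l, lo ≤ (idx l : ℕ) ∧ (idx l : ℕ) < hi) →
    qs (Fin.last m) = t →
    (∀ l : Fin m,
      (qs l.castSucc = (A (idx l)).1.1 ∨ qs l.castSucc = (A (idx l)).1.2) ∧
      (qs l.succ = (A (idx l)).1.1 ∨ qs l.succ = (A (idx l)).1.2)) →
    qs 0 ∈ Reach t (((List.ofFn (arch A)).take hi).drop lo) := by
  induction m with
  | zero =>
    intro lo idx qs _ _ ht _
    have : qs 0 = t := ht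
    rw [this]
    exact mem_Reach_self _ _
  | succ m ih =>
    intro lo idx qs hmono hidx ht hpath
    have h1 := ih (idx 0 + 1) (fun l => idx l.succ) (fun l => qs l.succ)
      (fun a b hab => hmono (Fin.succ_lt_succ_iff.2 hab))
      (fun l => ⟨hmono (Fin.succ_pos l), (hidx l.succ).2⟩) ht
      (fun l => by simpa using hpath l.succ)
    set K := (List.ofFn (arch A)).take hi with hK
    have hlen : (idx 0 : ℕ) < K.length := by
      rw [hK, List.length_take, List.length_ofFn]
      exact lt_min (hidx 0).2 (idx 0).2
    have hget : K[(idx 0 : ℕ)] = A (idx 0) := by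
      simp [hK]; rfl
    have h2 : K.drop lo = (K.drop lo).take (idx 0 - lo) ++ (A (idx 0) :: K.drop (idx 0 + 1)) := by
      rw [← hget, ← List.drop_eq_getElem_cons hlen]
      conv_lhs => rw [← List.take_append_drop (idx 0 - lo) (K.drop lo)]
      rw [List.drop_drop, Nat.add_sub_cancel' (hidx 0).1]
    rw [h2]
    apply Reach_append
    obtain ⟨p1, p2⟩ := hpath 0
    refine Or.inr ⟨?_, p1⟩
    rcases p2 with h | h
    · left; rw [← h]; exact h1
    · right; rw [← h]; exact h1

theorem RS_ofFn {n : ℕ} : ∀ {R : ℕ} (A : Architecture n R) (M : NMatrix n),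
    M ∈ RS (List.ofFn (arch A)) → ∃ x, contract A x = M := by
  intro R
  induction R with
  | zero =>
    intro A M hM
    refine ⟨fun i => i.elim0, ?_⟩
    have : M = 1 := by simpa [RS] using hM
    rw [this]
    simp [contract, gateList]
  | succ R ih =>
    intro A M hM
    rw [List.ofFn_succ] at hM
    obtain ⟨V, hV, u, rfl⟩ := hM
    obtain ⟨x, hx⟩ := ih (fun i => arch A i.succ) V hV
    refine ⟨Fin.cons u x, ?_⟩
    rw [← hx]
    simp only [contract, gateList, List.ofFn_succ, List.reverse_cons, List.prod_append,
      List.prod_singleton, Fin.cons_zero, Fin.cons_succ]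
    rfl

theorem final {n T L : ℕ} (hn : 2 ≤ n) (hT : T ≤ 4 ^ n - 1)
    (A : Architecture n (T * L))
    (hslices : ∀ s < T, IsCausalSlice A (s * L) ((s + 1) * L)) :
    (T : ℝ≥0∞) ≤ accessibleDim A := by
  obtain ⟨g, D, hg, hD, hinj⟩ := main_curve hn L (List.ofFn (arch A)) T hT (by
    intro s hs
    obtain ⟨t, ht⟩ := hslices s hs
    refine ⟨t, fun q => ?_⟩
    obtain ⟨m, idx, qs, h1, h2, h3, h4, h5⟩ := ht q
    have := reach_of_path A ((s + 1) * L) t m (s * L) idx qs h1 h2 h4 h5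
    rw [h3] at this
    rw [List.take_drop, ← Nat.succ_mul]
    exact this)
  rw [List.take_of_length_le (by simp)] at hg
  obtain ⟨π, hπ⟩ := LinearMap.exists_leftInverse_of_injective
    (D : (Fin T → ℝ) →ₗ[ℝ] NMatrix n) (LinearMap.ker_eq_bot.2 hinj)
  let π' : NMatrix n →L[ℝ] (Fin T → ℝ) := LinearMap.toContinuousLinearMap π
  have hf : HasStrictFDerivAt (fun θ => π' (g θ)) (π'.comp D) 0 :=
    π'.hasStrictFDerivAt.comp 0 hD
  have hid : ∀ v, π' (D v) = v := fun v => LinearMap.congr_fun hπ v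
  have hsurj : (π'.comp D).range = ⊤ := by
    rw [LinearMap.range_eq_top]
    exact fun v => ⟨v, hid v⟩
  have hmap := hf.map_nhds_eq_of_surj hsurj
  have hnhds : Set.range (fun θ => π' (g θ)) ∈ nhds (π' (g 0)) := by
    rw [← hmap]
    exact Filter.mem_map.2 (Filter.univ_mem' fun θ => ⟨θ, rfl⟩)
  have hdim : dimH (Set.range (fun θ => π' (g θ))) = T := by
    rw [Real.dimH_of_nonempty_interior ⟨_, mem_interior_iff_mem_nhds.2 hnhds⟩]
    simp
  let ρ : EuclideanSpace ℂ (QubitBasis n × QubitBasis n) →ₗ[ℝ] (Fin T → ℝ) :=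
    { toFun := fun v => π (fun a b => v (a, b))
      map_add' := fun v w => π.map_add (fun a b => v (a, b)) (fun a b => w (a, b))
      map_smul' := fun r v => π.map_smul r (fun a b => v (a, b)) }
  let ρ' := LinearMap.toContinuousLinearMap ρ
  have hsub : Set.range (fun θ => π' (g θ)) ⊆ ρ' '' (toEuc '' Set.range (contract A)) := by
    rintro _ ⟨θ, rfl⟩
    obtain ⟨x, hx⟩ := RS_ofFn A _ (hg θ)
    exact ⟨toEuc (g θ), ⟨g θ, ⟨x, hx⟩, rfl⟩, rfl⟩
  rw [← hdim, accessibleDim]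
  exact (dimH_mono hsub).trans (ρ'.lipschitz.dimH_image_le _)

end AccDim

/-! ## Statement 2: lower bound on the accessible dimension -/

/-- **Lower bound on the accessible dimension.**
Let `A` be an `n`-qubit architecture with `R = T·L` gates that is the concatenation of `T`
consecutive causal slices of `L` gates each, with `T ≤ 4^n − 1`.  Then the accessible
dimension of `A` is at least `T = R/L`. -/
theorem accessible_dimension_lower_bound
    (n T L : ℕ) (hn : 2 ≤ n) (hT : T ≤ 4 ^ n - 1)
    (A : Architecture n (T * L))
    (hslices : ∀ s < T, IsCausalSlice A (s * L) ((s + 1) * L)) :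
    (T : ℝ≥0∞) ≤ accessibleDim A := by
  exact AccDim.final hn hT A hslices
end

section
/- Let n ≥ 2 and let A be any n-qubit architecture with R gates. Then the accessible dimension equals the maximal rank of the contraction map: d_A = r_max(A), where r_max(A) is the maximum over x ∈ SU(4)^{×R} of the rank of the differential of F^A at x. -/
open scoped Matrix ENNReal Classical Kronecker ComplexOrder
open MeasureTheory

/-! ## Statement 5: the accessible dimension equals the maximal rank -/


section UD
open TensorProduct
theorem ud_linInd {k K ι : Type} [Field k] [CharZero k] [Field K] [Algebra k K]
    [Algebra.EssFiniteType k K] (v : ι → K) (hv : AlgebraicIndependent k v) :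
    LinearIndependent K (fun i => KaehlerDifferential.D k K (v i)) := by
  let : Algebra (MvPolynomial ι k) K := (MvPolynomial.aeval v).toRingHom.toAlgebra
  have hmap : ∀ p : MvPolynomial ι k, algebraMap (MvPolynomial ι k) K p = MvPolynomial.aeval v p :=
    fun p => rfl
  have : IsScalarTower k (MvPolynomial ι k) K := IsScalarTower.of_algebraMap_eq (fun x => by
    rw [hmap]; simp)
  have : FaithfulSMul (MvPolynomial ι k) K := by
    rw [faithfulSMul_iff_algebraMap_injective]
    exact hv
  let L := FractionRing (MvPolynomial ι k)
  let : Algebra L K := FractionRing.liftAlgebra (MvPolynomial ι k) K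
  have : IsScalarTower (MvPolynomial ι k) L K := inferInstance
  have : IsScalarTower k L K := IsScalarTower.of_algebraMap_eq (fun x => by
    rw [IsScalarTower.algebraMap_apply k (MvPolynomial ι k) K,
      IsScalarTower.algebraMap_apply k (MvPolynomial ι k) L]
    exact IsScalarTower.algebraMap_apply (MvPolynomial ι k) L K _)
  have : Algebra.EssFiniteType L K := Algebra.EssFiniteType.of_comp k L K
  have : CharZero L := charZero_of_injective_algebraMap (algebraMap k L).injective
  have : Algebra.FormallySmooth L K := inferInstance
  have : Algebra.FormallySmooth (MvPolynomial ι k) L :=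
    .of_isLocalization (nonZeroDivisors _)
  have : Algebra.FormallySmooth (MvPolynomial ι k) K := .comp _ L _
  have hinj : Function.Injective (KaehlerDifferential.mapBaseChange k (MvPolynomial ι k) K) := by
    rw [injective_iff_map_eq_zero]
    intro x hx
    obtain ⟨y, rfl⟩ := (Algebra.H1Cotangent.exact_δ_mapBaseChange k (MvPolynomial ι k) K x).mp hx
    rw [Subsingleton.elim y 0, map_zero]
  have hb := ((KaehlerDifferential.mvPolynomialBasis k ι).baseChange K).linearIndependent
  have := hb.map' (KaehlerDifferential.mapBaseChange k (MvPolynomial ι k) K)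
    (LinearMap.ker_eq_bot.mpr hinj)
  have e : (fun i => KaehlerDifferential.D k K (v i)) =
      (KaehlerDifferential.mapBaseChange k (MvPolynomial ι k) K) ∘
      ((KaehlerDifferential.mvPolynomialBasis k ι).baseChange K) := by
    ext i
    simp [KaehlerDifferential.mvPolynomialBasis_apply, hmap]
  rw [e]
  exact this

theorem ud_derivs {k K ι : Type} [Field k] [CharZero k] [Field K] [Algebra k K]
    [Algebra.EssFiniteType k K] (v : ι → K) (hv : AlgebraicIndependent k v) [DecidableEq ι] :
    ∃ D : ι → Derivation k K K, ∀ i j, D i (v j) = if i = j then 1 else 0 := by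
  have h := ud_linInd v hv
  have : ∀ i, ∃ f : Ω[K⁄k] →ₗ[K] K, ∀ j, f (KaehlerDifferential.D k K (v j)) =
      if i = j then 1 else 0 := by
    intro i
    obtain ⟨f, hf⟩ := LinearMap.exists_extend ((Finsupp.lapply i : (ι →₀ K) →ₗ[K] K) ∘ₗ h.repr)
    refine ⟨f, fun j => ?_⟩
    have h1 := LinearMap.congr_fun hf ⟨KaehlerDifferential.D k K (v j),
      Submodule.subset_span ⟨j, rfl⟩⟩
    simp only [LinearMap.comp_apply, Submodule.subtype_apply] at h1
    rw [h1]
    have := h.repr_eq_single j ⟨KaehlerDifferential.D k K (v j),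
      Submodule.subset_span ⟨j, rfl⟩⟩ rfl
    simp [this, Finsupp.single_apply, eq_comm]
  choose f hf using this
  exact ⟨fun i => (f i).compDer (KaehlerDifferential.D k K), fun i j => by simpa using hf i j⟩

open MvPolynomial in
theorem ud_rel {τ K : Type} [Field K] [Algebra ℝ K] (A : τ → K) (s : Set τ)
    (hs : AlgebraicIndependent ℝ (fun i : s => A i)) (t : τ)
    (hmax : ¬ AlgebraicIndependent ℝ (fun i : (insert t s : Set τ) => A i)) (ht : t ∉ s) :
    ∃ Q : MvPolynomial τ ℝ, aeval A Q = 0 ∧ aeval A (pderiv t Q) ≠ 0 ∧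
      ∀ t', t' ∉ s → t' ≠ t → pderiv t' Q = 0 := by
  let φ : MvPolynomial s ℝ →ₐ[ℝ] K := aeval (fun i : s => A i)
  have hφ : Function.Injective φ := hs
  have hex : ∃ m : ℕ, ∃ p : Polynomial (MvPolynomial s ℝ), p ≠ 0 ∧ p.eval₂ φ.toRingHom (A t) = 0 ∧
      p.natDegree = m := by
    have : IsAlgebraic (Algebra.adjoin ℝ (A '' s)) (A t) := by
      by_contra hcon
      apply hmax
      have := AlgebraicIndepOn.insert (x := A) (s := s) (i := t) hs hcon
      exact this
    rw [Set.image_eq_range] at this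
    obtain ⟨p, hp, hp0⟩ := this
    refine ⟨_, p.map hs.aevalEquiv.symm.toRingEquiv.toRingHom, ?_, ?_, rfl⟩
    · exact (Polynomial.map_ne_zero_iff hs.aevalEquiv.symm.injective).mpr hp
    · rw [Polynomial.eval₂_map, ← hp0, Polynomial.aeval_def]
      congr 1
      ext x
      have := hs.algebraMap_aevalEquiv (hs.aevalEquiv.symm x)
      rw [AlgEquiv.apply_symm_apply] at this
      exact this.symm
  classical
  obtain ⟨p, hp0, hp, hpm⟩ := Nat.find_spec hex
  have hmin : ∀ q : Polynomial (MvPolynomial s ℝ), q ≠ 0 → q.eval₂ φ.toRingHom (A t) = 0 →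
      p.natDegree ≤ q.natDegree := fun q h1 h2 => by
    rw [hpm]; exact Nat.find_min' hex ⟨q, h1, h2, rfl⟩
  have hdeg : p.natDegree ≠ 0 := by
    intro h
    rw [Polynomial.natDegree_eq_zero] at h
    obtain ⟨c, rfl⟩ := h
    simp only [Polynomial.eval₂_C] at hp
    exact hp0 (by rw [(map_eq_zero_iff φ hφ).mp hp, map_zero])
  have hder : (Polynomial.derivative p).eval₂ φ.toRingHom (A t) ≠ 0 := by
    intro h
    have h0 : Polynomial.derivative p ≠ 0 := by
      intro h0
      exact hdeg (Polynomial.derivative_eq_zero.mp h0)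
    have := hmin _ h0 h
    have := Polynomial.natDegree_derivative_lt hdeg
    omega
  let ρ : MvPolynomial s ℝ →+* MvPolynomial τ ℝ := (rename (Subtype.val : s → τ)).toRingHom
  have hρ : ∀ q : Polynomial (MvPolynomial s ℝ), aeval A (q.eval₂ ρ (X t)) =
      q.eval₂ φ.toRingHom (A t) := by
    intro q
    have := Polynomial.hom_eval₂ q ρ (aeval A : MvPolynomial τ ℝ →ₐ[ℝ] K).toRingHom (X t)
    simp only [AlgHom.toRingHom_eq_coe, RingHom.coe_coe, aeval_X] at this
    rw [this]
    congr 1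
    apply MvPolynomial.ringHom_ext
    · intro r; simp [ρ, φ]
    · intro r; simp [ρ, φ]
  have hd : ∀ t' ∉ s, ∀ c, pderiv t' (ρ c) = 0 := by
    intro t' ht' c
    refine pderiv_eq_zero_of_notMem_vars ?_
    intro hmem
    have := MvPolynomial.vars_rename (Subtype.val : s → τ) c hmem
    simp at this
    exact ht' this.choose
  have hd2 : ∀ t' ∉ s, ∀ q : Polynomial (MvPolynomial s ℝ),
      pderiv t' (q.eval₂ ρ (X t)) = (Polynomial.derivative q).eval₂ ρ (X t) * pderiv t' (X t) := by
    intro t' ht' q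
    induction q using Polynomial.induction_on' with
    | add p q hp hq => simp only [Polynomial.eval₂_add, map_add, hp, hq]; ring
    | monomial n a =>
      rw [Polynomial.derivative_monomial]
      simp [Polynomial.eval₂_monomial, Derivation.leibniz, hd t' ht', Derivation.leibniz_pow]
      ring
  refine ⟨p.eval₂ ρ (X t), by rw [hρ, hp], ?_, ?_⟩
  · rw [hd2 t ht, pderiv_X_self, mul_one, hρ]; exact hder
  · intro t' ht' hne
    rw [hd2 t' ht', pderiv_X_of_ne hne.symm, mul_zero]

open MvPolynomial in
theorem ud_eval_deriv {τ : Type} [Fintype τ] (p : MvPolynomial τ ℝ) (x : τ → ℝ) :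
    HasStrictFDerivAt (fun y : τ → ℝ => eval y p)
      (∑ i, eval x (pderiv i p) • (ContinuousLinearMap.proj i : (τ → ℝ) →L[ℝ] ℝ)) x := by
  classical
  induction p using MvPolynomial.induction_on with
  | C a => simpa using hasStrictFDerivAt_const (𝕜 := ℝ) a x
  | add p q hp hq =>
    simp only [map_add, add_smul, Finset.sum_add_distrib]
    exact hp.add hq
  | mul_X p i hp =>
    have h1 := hp.mul ((ContinuousLinearMap.proj i : (τ → ℝ) →L[ℝ] ℝ).hasStrictFDerivAt (x := x))
    refine (h1.congr_fderiv ?_).congr_of_eventuallyEq (Filter.Eventually.of_forall fun y => ?_)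
    · ext v
      simp [Derivation.leibniz, pderiv_X, Finset.sum_add_distrib, add_mul, Pi.single_apply,
        ite_mul, Finset.mul_sum, apply_ite]
      congr 1
      exact funext fun _ => by ring
    · simp

open MvPolynomial in
theorem ud_dim {τ : Type} [Fintype τ] (s : Set τ) (Q : τ → MvPolynomial τ ℝ)
    (hQ : ∀ t ∉ s, ∀ t' ∉ s, t' ≠ t → pderiv t' (Q t) = 0) :
    dimH {y : τ → ℝ | ∀ t ∉ s, eval y (Q t) = 0 ∧ eval y (pderiv t (Q t)) ≠ 0} ≤ (Nat.card s : ENNReal) := by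
  classical
  set S := {y : τ → ℝ | ∀ t ∉ s, eval y (Q t) = 0 ∧ eval y (pderiv t (Q t)) ≠ 0} with hS
  by_contra hcon
  push Not at hcon
  obtain ⟨y, hy, hlt⟩ := exists_mem_nhdsWithin_lt_dimH_of_lt_dimH hcon
  let Ψ : (τ → ℝ) → (τ → ℝ) := fun y t => if t ∈ s then y t else eval y (Q t)
  let L : (τ → ℝ) →L[ℝ] (τ → ℝ) := ContinuousLinearMap.pi fun t =>
    if t ∈ s then ContinuousLinearMap.proj t else
      ∑ i, eval y (pderiv i (Q t)) • (ContinuousLinearMap.proj i : (τ → ℝ) →L[ℝ] ℝ)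
  have hL : HasStrictFDerivAt Ψ L y := by
    rw [hasStrictFDerivAt_pi']
    intro t
    by_cases ht : t ∈ s
    · simp only [Ψ, L, ht, if_true, ContinuousLinearMap.proj_pi]
      exact (ContinuousLinearMap.proj t : (τ → ℝ) →L[ℝ] ℝ).hasStrictFDerivAt
    · simp only [Ψ, L, ht, if_false, ContinuousLinearMap.proj_pi]
      exact ud_eval_deriv _ _
  have hinj : Function.Injective L := by
    rw [injective_iff_map_eq_zero]
    intro v hv
    have h1 : ∀ t ∈ s, v t = 0 := fun t ht => by
      have := congrFun hv t
      simpa [L, ht] using this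
    ext t
    by_cases ht : t ∈ s
    · exact h1 t ht
    · have := congrFun hv t
      simp [L, ht] at this
      rw [Finset.sum_eq_single t] at this
      · exact (mul_eq_zero.mp this).resolve_left (hy t ht).2
      · intro b _ hb
        by_cases hbs : b ∈ s
        · simp [h1 b hbs]
        · simp [hQ t ht b hbs hb]
      · simp
  let e : (τ → ℝ) ≃L[ℝ] (τ → ℝ) :=
    (LinearEquiv.ofInjectiveEndo (L : (τ → ℝ) →ₗ[ℝ] (τ → ℝ)) hinj).toContinuousLinearEquiv
  have he : HasStrictFDerivAt Ψ (e : (τ → ℝ) →L[ℝ] (τ → ℝ)) y := by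
    refine hL.congr_fderiv ?_
    ext v t; rfl
  obtain ⟨K, U, hU, hK⟩ := he.to_localInverse.exists_lipschitzOnWith
  set g := he.localInverse Ψ e y
  let W : Set (τ → ℝ) := Set.range fun (w : s → ℝ) (t : τ) => if h : t ∈ s then w ⟨t, h⟩ else 0
  have hW : dimH W ≤ (Nat.card s : ENNReal) := by
    have : ContDiff ℝ 1 fun (w : s → ℝ) (t : τ) => if h : t ∈ s then w ⟨t, h⟩ else 0 := by
      rw [contDiff_pi]
      intro t
      by_cases ht : t ∈ s
      · simp only [ht, dite_true]; fun_prop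
      · simp only [ht, dite_false]; fun_prop
    refine this.dimH_range_le.trans ?_
    simp
  have hmem : {z | z ∈ S ∧ Ψ z ∈ U ∧ g (Ψ z) = z} ∈ nhdsWithin y S := by
    filter_upwards [self_mem_nhdsWithin, mem_nhdsWithin_of_mem_nhds (hL.continuousAt hU),
      mem_nhdsWithin_of_mem_nhds he.eventually_left_inverse] with z h1 h2 h3
    exact ⟨h1, h2, h3⟩
  refine absurd (hlt _ hmem) (not_lt.mpr ?_)
  calc _ ≤ dimH (g '' (U ∩ W)) := by
        apply dimH_mono
        rintro z ⟨h1, h2, h3⟩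
        refine ⟨Ψ z, ⟨h2, fun t => z t, ?_⟩, h3⟩
        ext t
        by_cases ht : t ∈ s
        · simp [Ψ, ht]
        · simp [Ψ, ht, (h1 t ht).1]
    _ ≤ dimH (U ∩ W) := (hK.mono Set.inter_subset_left).dimH_image_le
    _ ≤ dimH W := dimH_mono Set.inter_subset_right
    _ ≤ _ := hW

theorem ud_chain {σ K : Type} [Fintype σ] [Field K] [Algebra ℝ K] (D : Derivation ℝ K K)
    (ξ : σ → K) (p : MvPolynomial σ ℝ) :
    D (MvPolynomial.aeval ξ p) =
      ∑ i, MvPolynomial.aeval ξ (MvPolynomial.pderiv i p) * D (ξ i) := by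
  classical
  induction p using MvPolynomial.induction_on with
  | C a => simp
  | add p q hp hq =>
    simp only [map_add, add_mul, Finset.sum_add_distrib, hp, hq]
  | mul_X p i hp =>
    simp [Derivation.leibniz, MvPolynomial.pderiv_X, Finset.sum_add_distrib, add_mul,
      Pi.single_apply, ite_mul, Finset.mul_sum, apply_ite, hp]
    exact Finset.sum_congr rfl fun _ _ => by ring

open MvPolynomial in
theorem ud_upper {σ τ : Type} [Fintype σ] [Fintype τ] (Fp : τ → MvPolynomial σ ℝ)
    (I0 : Ideal (MvPolynomial σ ℝ)) (r : ℕ)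
    (H : ∀ x : σ → ℝ, (∀ p ∈ I0, eval x p = 0) → ∀ (s : Set τ) (v : s → σ → ℝ),
      (∀ a, ∀ p ∈ I0, ∑ i, eval x (pderiv i p) * v a i = 0) →
      (∃ c : ℝ, c ≠ 0 ∧ ∀ a b : s, ((a = b → ∑ i, eval x (pderiv i (Fp b)) * v a i = c) ∧
        (a ≠ b → ∑ i, eval x (pderiv i (Fp b)) * v a i = 0))) → Nat.card s ≤ r)
    (I : Ideal (MvPolynomial σ ℝ)) (hI : I0 ≤ I) :
    dimH ((fun (x : σ → ℝ) (t : τ) => eval x (Fp t)) '' {x | ∀ p ∈ I, eval x p = 0}) ≤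
      (r : ENNReal) := by
  classical
  induction I using WellFoundedGT.induction with
  | ind I ih =>
  set f : (σ → ℝ) → (τ → ℝ) := fun x t => eval x (Fp t) with hf
  have step : ∀ d ∉ I, dimH (f '' {x | (∀ p ∈ I, eval x p = 0) ∧ eval x d = 0}) ≤ (r : ENNReal) := by
    intro d hd
    have hlt : I < I ⊔ Ideal.span {d} := by
      refine lt_of_le_of_ne le_sup_left fun h => hd ?_
      rw [h]
      exact Ideal.mem_sup_right (Ideal.mem_span_singleton_self d)
    refine le_trans (dimH_mono (Set.image_mono ?_)) (ih _ hlt (hI.trans le_sup_left))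
    rintro x ⟨h1, h2⟩
    have : I ⊔ Ideal.span {d} ≤ RingHom.ker (eval x) := by
      refine sup_le (fun p hp => h1 p hp) ?_
      rw [Ideal.span_singleton_le_iff_mem]
      exact h2
    exact fun p hp => this hp
  by_cases hprime : I.IsPrime
  swap
  · rw [Ideal.isPrime_iff] at hprime
    by_cases htop : I = ⊤
    · have : {x : σ → ℝ | ∀ p ∈ I, eval x p = 0} = ∅ := by
        ext x
        simp only [Set.mem_ofPred_eq, Set.mem_empty_iff_false, iff_false]
        intro h
        have := h 1 (by rw [htop]; trivial)
        simp at this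
      rw [this]; simp
    · have : ∃ a b, a * b ∈ I ∧ a ∉ I ∧ b ∉ I := by
        by_contra hcon
        push Not at hcon
        exact hprime ⟨htop, fun {a b} hab => or_iff_not_imp_left.mpr fun ha => hcon a b hab ha⟩
      obtain ⟨a, b, hab, ha, hb⟩ := this
      refine le_trans (dimH_mono (t := (f '' {x | (∀ p ∈ I, eval x p = 0) ∧ eval x a = 0}) ∪
        (f '' {x | (∀ p ∈ I, eval x p = 0) ∧ eval x b = 0})) ?_) ?_
      · rintro _ ⟨x, hx, rfl⟩
        have := hx _ hab
        rw [map_mul, mul_eq_zero] at this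
        rcases this with h | h
        · exact Or.inl ⟨x, ⟨hx, h⟩, rfl⟩
        · exact Or.inr ⟨x, ⟨hx, h⟩, rfl⟩
      · rw [dimH_union]
        exact max_le (step a ha) (step b hb)
  let B := MvPolynomial σ ℝ ⧸ I
  let K := FractionRing B
  let ξ : σ → K := fun i => algebraMap B K (Ideal.Quotient.mk I (X i))
  have hξ : ∀ p, aeval ξ p = algebraMap B K (Ideal.Quotient.mk I p) := by
    intro p
    have : aeval ξ = (IsScalarTower.toAlgHom ℝ B K).comp (Ideal.Quotient.mkₐ ℝ I) := by
      apply MvPolynomial.algHom_ext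
      intro i
      simp only [ξ, AlgHom.comp_apply, aeval_X]
      rfl
    rw [this]; rfl
  have hξ0 : ∀ p, aeval ξ p = 0 ↔ p ∈ I := by
    intro p
    rw [hξ, ← Ideal.Quotient.eq_zero_iff_mem]
    exact map_eq_zero_iff _ (IsFractionRing.injective B K)
  let A : τ → K := fun t => aeval ξ (Fp t)
  have hA : ∀ q : MvPolynomial τ ℝ, aeval A q = aeval ξ (bind₁ Fp q) := by
    intro q
    rw [aeval_bind₁]
  have hbind : ∀ (q : MvPolynomial τ ℝ) (x : σ → ℝ), eval (f x) q = eval x (bind₁ Fp q) := by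
    intro q x
    have := (aeval_bind₁ (R := ℝ) (f := x) (g := Fp) (φ := q))
    simp only [← MvPolynomial.coe_aeval_eq_eval]
    simpa [hf] using this.symm
  obtain ⟨s, hs⟩ : ∃ s : Set τ, Maximal (fun s : Set τ => AlgebraicIndependent ℝ (fun i : s => A i)) s := by
    refine Set.Finite.exists_maximal (Set.toFinite _) ⟨∅, ?_⟩
    exact (algebraicIndependent_empty_type_iff).mpr (algebraMap ℝ K).injective
  have hQex : ∀ t, ∃ Q : MvPolynomial τ ℝ, t ∉ s → (aeval A Q = 0 ∧ aeval A (pderiv t Q) ≠ 0 ∧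
      ∀ t', t' ∉ s → t' ≠ t → pderiv t' Q = 0) := by
    intro t
    by_cases ht : t ∈ s
    · exact ⟨0, fun h => absurd ht h⟩
    · obtain ⟨Q, hQ⟩ := ud_rel A s hs.1 t (fun h => ht (hs.2 h (Set.subset_insert t s)
        (Set.mem_insert t s))) ht
      exact ⟨Q, fun _ => hQ⟩
  choose Q hQ using hQex
  obtain ⟨D, hD⟩ := ud_derivs _ hs.1
  obtain ⟨b, hb⟩ := IsLocalization.exist_integer_multiples_of_finite (nonZeroDivisors B)
    (fun ai : s × σ => D ai.1 (ξ ai.2))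
  choose u hu using hb
  choose v hv using fun ai => Ideal.Quotient.mk_surjective (u ai)
  obtain ⟨d, hd⟩ := Ideal.Quotient.mk_surjective (b : B)
  have hdI : d ∉ I := by
    rw [← Ideal.Quotient.eq_zero_iff_mem, hd]
    exact nonZeroDivisors.coe_ne_zero b
  have hkey : ∀ (a : s) (p : MvPolynomial σ ℝ), aeval ξ (∑ i, pderiv i p * v (a, i)) =
      aeval ξ d * D a (aeval ξ p) := by
    intro a p
    rw [ud_chain, map_sum, Finset.mul_sum]
    refine Finset.sum_congr rfl fun i _ => ?_
    rw [map_mul, hξ (v (a, i)), hv, hu, hξ d, hd]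
    simp only [Algebra.smul_def]
    ring
  by_cases hpt : ∃ x : σ → ℝ, (∀ p ∈ I, eval x p = 0) ∧ eval x d ≠ 0
  swap
  · push Not at hpt
    refine le_trans (dimH_mono (Set.image_mono ?_)) (step d hdI)
    exact fun x hx => ⟨hx, hpt x hx⟩
  have hcard : Nat.card s ≤ r := by
    obtain ⟨x, hx, hxd⟩ := hpt
    refine H x (fun p hp => hx p (hI hp)) s (fun a i => eval x (v (a, i))) ?_ ⟨eval x d, hxd, ?_⟩
    · intro a p hp
      have h1 := hkey a p
      rw [(hξ0 p).mpr (hI hp), map_zero, mul_zero, hξ0] at h1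
      simpa using hx _ h1
    · intro a b
      have h1 := hkey a (Fp b)
      have h2 : D a (aeval ξ (Fp b)) = _ := hD a b
      rw [h2] at h1
      constructor
      · rintro rfl
        rw [if_pos rfl, mul_one, ← sub_eq_zero, ← map_sub, hξ0] at h1
        have := hx _ h1
        rw [map_sub, sub_eq_zero] at this
        simpa using this
      · intro hne
        rw [if_neg hne, mul_zero, hξ0] at h1
        simpa using hx _ h1
  refine le_trans (dimH_mono (t := {y : τ → ℝ | ∀ t ∉ s, eval y (Q t) = 0 ∧
    eval y (pderiv t (Q t)) ≠ 0} ∪ ⋃ t : (sᶜ : Set τ), (f '' {x | (∀ p ∈ I, eval x p = 0) ∧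
      eval x (bind₁ Fp (pderiv (t : τ) (Q t))) = 0})) ?_) ?_
  · rintro _ ⟨x, hx, rfl⟩
    by_cases hz : ∃ t : (sᶜ : Set τ), eval x (bind₁ Fp (pderiv (t : τ) (Q t))) = 0
    · obtain ⟨t, ht⟩ := hz
      exact Or.inr (Set.mem_iUnion.mpr ⟨t, x, ⟨hx, ht⟩, rfl⟩)
    · push Not at hz
      refine Or.inl fun t ht => ⟨?_, ?_⟩
      · change eval (f x) _ = 0
        rw [hbind]
        exact hx _ ((hξ0 _).mp (by rw [← hA]; exact (hQ t ht).1))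
      · change eval (f x) _ ≠ 0
        rw [hbind]
        exact hz ⟨t, ht⟩
  · rw [dimH_union, dimH_iUnion]
    refine max_le ?_ (iSup_le fun t => step _ ?_)
    · exact (ud_dim s Q fun t ht => (hQ t ht).2.2).trans (by exact_mod_cast hcard)
    · rw [← hξ0, ← hA]
      exact (hQ t t.2).2.1

end UD

section BB

theorem bb_su_mem {m : Type*} [Fintype m] [DecidableEq m] (H : Matrix m m ℂ) :
    H ∈ suAlgebra m ↔ (Hᴴ = -H ∧ H.trace = 0) := by
  constructor
  · intro h
    unfold suAlgebra at h
    induction h using Submodule.span_induction with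
    | mem x h => exact h
    | zero => simp
    | add x y _ _ hx hy =>
      refine ⟨?_, ?_⟩
      · rw [Matrix.conjTranspose_add, hx.1, hy.1]; abel
      · rw [Matrix.trace_add, hx.2, hy.2, add_zero]
    | smul a x _ hx =>
      refine ⟨?_, ?_⟩
      · rw [Matrix.conjTranspose_smul, hx.1]; simp
      · rw [Matrix.trace_smul, hx.2, smul_zero]
  · intro h
    exact Submodule.subset_span h

theorem bb_pair_surj : Function.Bijective (fun q : Fin 2 × Fin 2 => pairIdx q.1 q.2) := by
  decide

theorem bb_embed_mul {n : ℕ} (p : Fin n × Fin n) (hp : p.1 ≠ p.2)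
    (u w : Matrix (Fin 4) (Fin 4) ℂ) :
    embedGate p u * embedGate p w = embedGate p (u * w) := by
  ext a c
  rw [Matrix.mul_apply]
  have hs : ∀ b : QubitBasis n, embedGate p u a b * embedGate p w b c =
      if (∀ i, i ≠ p.1 → i ≠ p.2 → a i = b i) then
        u (pairIdx (a p.1) (a p.2)) (pairIdx (b p.1) (b p.2)) * embedGate p w b c else 0 := by
    intro b
    simp only [embedGate]
    split_ifs <;> simp
  simp only [hs]
  rw [← Finset.sum_filter]
  have key : ∑ b ∈ Finset.univ.filter (fun b : QubitBasis n => ∀ i, i ≠ p.1 → i ≠ p.2 → a i = b i),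
      u (pairIdx (a p.1) (a p.2)) (pairIdx (b p.1) (b p.2)) * embedGate p w b c =
      ∑ q : Fin 2 × Fin 2, u (pairIdx (a p.1) (a p.2)) (pairIdx q.1 q.2) *
        embedGate p w (Function.update (Function.update a p.1 q.1) p.2 q.2) c := by
    symm
    refine Finset.sum_bij (fun q _ => Function.update (Function.update a p.1 q.1) p.2 q.2) ?_ ?_ ?_ ?_
    · intro q _
      simp only [Finset.mem_filter, Finset.mem_univ, true_and]
      intro i h1 h2
      simp [Function.update_of_ne, h1, h2]
    · intro q _ q' _ h
      have h1 := congrFun h p.1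
      have h2 := congrFun h p.2
      simp [Function.update_of_ne, hp] at h1 h2
      exact Prod.ext h1 h2
    · intro b hb
      simp only [Finset.mem_filter, Finset.mem_univ, true_and] at hb
      refine ⟨(b p.1, b p.2), Finset.mem_univ _, ?_⟩
      funext i
      by_cases h2 : i = p.2
      · subst h2; simp
      · by_cases h1 : i = p.1
        · subst h1; simp [Function.update_of_ne, h2]
        · simp [Function.update_of_ne, h1, h2, hb i h1 h2]
    · intro q _
      simp [Function.update_of_ne, hp]
  rw [key]
  have key2 : ∀ q : Fin 2 × Fin 2,
      embedGate p w (Function.update (Function.update a p.1 q.1) p.2 q.2) c =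
      if (∀ i, i ≠ p.1 → i ≠ p.2 → a i = c i) then
        w (pairIdx q.1 q.2) (pairIdx (c p.1) (c p.2)) else 0 := by
    intro q
    unfold embedGate
    have : (∀ i, i ≠ p.1 → i ≠ p.2 →
        Function.update (Function.update a p.1 q.1) p.2 q.2 i = c i) ↔
        (∀ i, i ≠ p.1 → i ≠ p.2 → a i = c i) := by
      refine forall_congr' fun i => forall_congr' fun h1 => forall_congr' fun h2 => ?_
      simp [Function.update_of_ne, h1, h2]
    simp only [this]
    simp [Function.update_of_ne, hp]
  simp only [key2]
  unfold embedGate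
  split_ifs with h
  · rw [Matrix.mul_apply]
    exact Function.Bijective.sum_comp bb_pair_surj
      (fun k => u (pairIdx (a p.1) (a p.2)) k * w k (pairIdx (c p.1) (c p.2)))
  · simp

theorem bb_exp_mem (H : Matrix (Fin 4) (Fin 4) ℂ) (hH : H ∈ suAlgebra (Fin 4)) :
    NormedSpace.exp H ∈ Matrix.specialUnitaryGroup (Fin 4) ℂ := by
  rw [bb_su_mem] at hH
  obtain ⟨h1, h2⟩ := hH
  rw [Matrix.mem_specialUnitaryGroup_iff]
  constructor
  · rw [Matrix.mem_unitaryGroup_iff', Matrix.star_eq_conjTranspose, ← Matrix.exp_conjTranspose, h1,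
      ← Matrix.exp_add_of_commute _ _ (Commute.neg_left (Commute.refl H))]
    simp
  · have hB : ((-Complex.I) • H).IsHermitian := by
      unfold Matrix.IsHermitian
      rw [Matrix.conjTranspose_smul, h1]
      simp
    have hsp := hB.spectral_theorem
    rw [Unitary.conjStarAlgAut_apply] at hsp
    set U := hB.eigenvectorUnitary with hU
    have hUu : (star (U : Matrix (Fin 4) (Fin 4) ℂ)) = (U : Matrix (Fin 4) (Fin 4) ℂ)⁻¹ := by
      symm
      apply Matrix.inv_eq_left_inv
      simp
    have hUi : IsUnit (U : Matrix (Fin 4) (Fin 4) ℂ) :=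
      ⟨Unitary.toUnits U, rfl⟩
    have hH : H = (U : Matrix (Fin 4) (Fin 4) ℂ) *
        Matrix.diagonal (fun i => Complex.I * (hB.eigenvalues i : ℂ)) *
        (U : Matrix (Fin 4) (Fin 4) ℂ)⁻¹ := by
      have : H = Complex.I • ((-Complex.I) • H) := by
        rw [smul_smul]; simp
      refine this.trans ((congrArg (fun Z => Complex.I • Z) hsp).trans ?_)
      rw [← hUu]
      have hd : Matrix.diagonal (fun i => Complex.I * (hB.eigenvalues i : ℂ)) =
        Complex.I • Matrix.diagonal (RCLike.ofReal ∘ hB.eigenvalues : Fin 4 → ℂ) := by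
        rw [← Matrix.diagonal_smul]
        rfl
      rw [hd, Matrix.mul_smul, Matrix.smul_mul]
    have htr : ∑ i, Complex.I * (hB.eigenvalues i : ℂ) = 0 := by
      rw [← h2]
      conv_rhs => rw [hH]
      rw [Matrix.trace_mul_comm, ← mul_assoc, Matrix.nonsing_inv_mul _ ((Matrix.isUnit_iff_isUnit_det _).1 hUi), one_mul,
        Matrix.trace_diagonal]
    rw [hH, Matrix.exp_conj _ _ hUi, Matrix.det_conj hUi, Matrix.exp_diagonal, Matrix.det_diagonal]
    have : ∀ i, NormedSpace.exp (fun i => Complex.I * (hB.eigenvalues i : ℂ)) i =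
      Complex.exp (Complex.I * (hB.eigenvalues i : ℂ)) := by
      intro i
      rw [Pi.coe_exp, Complex.exp_eq_exp_ℂ]
    simp only [this]
    rw [← Complex.exp_sum, htr, Complex.exp_zero]

theorem bb_list_deriv {𝔸 E : Type*} [NormedRing 𝔸] [NormedAlgebra ℝ 𝔸] [NormedAddCommGroup E]
    [NormedSpace ℝ E] (e : E) : ∀ (R : ℕ) (g : Fin R → E → 𝔸) (g' : Fin R → E →L[ℝ] 𝔸),
    (∀ i, HasStrictFDerivAt (g i) (g' i) e) →
    ∃ L : E →L[ℝ] 𝔸, HasStrictFDerivAt (fun y => (List.ofFn fun i => g i y).reverse.prod) L e ∧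
      ∀ v, L v = ∑ j : Fin R, (((List.ofFn fun i => g i e).drop (j + 1)).reverse.prod) *
        (g' j v * ((List.ofFn fun i => g i e).take j).reverse.prod) := by
  intro R
  induction R with
  | zero =>
    intro g g' hg
    refine ⟨0, ?_, ?_⟩
    · simpa using hasStrictFDerivAt_const (1 : 𝔸) e
    · intro v; simp
  | succ R ih =>
    intro g g' hg
    obtain ⟨L, hL, hLv⟩ := ih (fun i => g i.succ) (fun i => g' i.succ) (fun i => hg i.succ)
    have := hL.mul' (hg 0)
    refine ⟨(List.ofFn fun i => g i.succ e).reverse.prod • g' 0 + MulOpposite.op (g 0 e) • L, ?_, ?_⟩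
    · convert this using 1
      funext y
      simp [List.ofFn_succ]
    · intro v
      rw [Fin.sum_univ_succ]
      simp [List.ofFn_succ, hLv, Finset.sum_mul, mul_assoc]

attribute [local instance] Matrix.linftyOpNormedRing Matrix.linftyOpNormedAlgebra

theorem bb_contr_deriv {n R : ℕ} (A : Architecture n R) (x : Fin R → SU4) {E : Type*}
    [NormedAddCommGroup E] [NormedSpace ℝ E] {F : Type*}
    [NormedAddCommGroup F] [NormedSpace ℝ F] (Θ : NMatrix n →ₗ[ℝ] F) (e : E)
    (y : Fin R → E → Matrix (Fin 4) (Fin 4) ℂ) (y' : Fin R → E →L[ℝ] Matrix (Fin 4) (Fin 4) ℂ)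
    (hy : ∀ i, HasStrictFDerivAt (y i) (y' i) e)
    (hx : ∀ i, y i e = (x i : Matrix (Fin 4) (Fin 4) ℂ)) :
    ∃ L : E →L[ℝ] F,
      HasStrictFDerivAt (fun t => Θ ((List.ofFn fun i => embedGate (A i).1 (y i t)).reverse.prod)) L e ∧
      ∀ v (H : Fin R → Matrix (Fin 4) (Fin 4) ℂ),
        (∀ i, y' i v = H i * (x i : Matrix (Fin 4) (Fin 4) ℂ)) → L v = Θ (contractDiff A x H) := by
  obtain ⟨L, hL, hLv⟩ := bb_list_deriv e R (fun i t => embedGate (A i).1 (y i t))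
    (fun i => (LinearMap.toContinuousLinearMap (embedLin (A i).1)).comp (y' i))
    (fun i => (LinearMap.toContinuousLinearMap (embedLin (A i).1)).hasStrictFDerivAt.comp e (hy i))
  refine ⟨(LinearMap.toContinuousLinearMap Θ).comp L,
    (LinearMap.toContinuousLinearMap Θ).hasStrictFDerivAt.comp e hL, ?_⟩
  intro v H hH
  change Θ (L v) = _
  refine congrArg Θ ((hLv v).trans ?_)
  simp only [hx]
  unfold contractDiff
  rw [LinearMap.sum_apply]
  refine Finset.sum_congr rfl fun j _ => ?_
  have : (embedLin (A j).1) (y' j v) = embedLin (A j).1 (H j) *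
      embedGate (A j).1 (x j : Matrix (Fin 4) (Fin 4) ℂ) := by
    rw [hH]
    exact (bb_embed_mul _ (A j).2 _ _).symm
  change _ * (embedLin (A j).1 (y' j v) * _) = _
  rw [this]
  simp [gateList, mul_assoc]

theorem bb_up {n R : ℕ} (A : Architecture n R) (x : Fin R → SU4) {E : Type*}
    [NormedAddCommGroup E] [NormedSpace ℝ E] [FiniteDimensional ℝ E] {F : Type*}
    [NormedAddCommGroup F] [NormedSpace ℝ F] (Θ : NMatrix n →ₗ[ℝ] F) (e : E)
    (Λ : Fin R → E →ₗ[ℝ] Matrix (Fin 4) (Fin 4) ℂ)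
    (hx : ∀ i, Λ i e = (x i : Matrix (Fin 4) (Fin 4) ℂ)) :
    ∃ L : E →L[ℝ] F,
      HasStrictFDerivAt (fun t => Θ ((List.ofFn fun i => embedGate (A i).1 (Λ i t)).reverse.prod)) L e ∧
      ∀ v (H : Fin R → Matrix (Fin 4) (Fin 4) ℂ),
        (∀ i, Λ i v = H i * (x i : Matrix (Fin 4) (Fin 4) ℂ)) → L v = Θ (contractDiff A x H) :=
  bb_contr_deriv A x Θ e (fun i => Λ i) (fun i => LinearMap.toContinuousLinearMap (Λ i))
    (fun i => (LinearMap.toContinuousLinearMap (Λ i)).hasStrictFDerivAt) hx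

theorem bb_low {n R : ℕ} (A : Architecture n R) (x : Fin R → SU4) {E : Type*}
    [NormedAddCommGroup E] [NormedSpace ℝ E] [FiniteDimensional ℝ E] {F : Type*}
    [NormedAddCommGroup F] [NormedSpace ℝ F] (Θ : NMatrix n →ₗ[ℝ] F)
    (Λ : Fin R → E →ₗ[ℝ] Matrix (Fin 4) (Fin 4) ℂ) :
    ∃ L : E →L[ℝ] F,
      HasStrictFDerivAt (fun t => Θ ((List.ofFn fun i => embedGate (A i).1
        (NormedSpace.exp (Λ i t) * (x i : Matrix (Fin 4) (Fin 4) ℂ))).reverse.prod)) L 0 ∧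
      ∀ v, L v = Θ (contractDiff A x (fun i => Λ i v)) := by
  obtain ⟨L, hL, hLv⟩ := bb_contr_deriv A x Θ 0
    (fun i t => NormedSpace.exp (Λ i t) * (x i : Matrix (Fin 4) (Fin 4) ℂ))
    (fun i => LinearMap.toContinuousLinearMap
      (LinearMap.mulRight ℝ (x i : Matrix (Fin 4) (Fin 4) ℂ) ∘ₗ Λ i))
    (fun i => by
      have h0 : HasStrictFDerivAt (NormedSpace.exp : Matrix (Fin 4) (Fin 4) ℂ → _)
          (1 : Matrix (Fin 4) (Fin 4) ℂ →L[ℝ] Matrix (Fin 4) (Fin 4) ℂ)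
          ((LinearMap.toContinuousLinearMap (Λ i)) (0 : E)) := by
        have := hasStrictFDerivAt_exp_zero (𝕂 := ℝ) (𝔸 := Matrix (Fin 4) (Fin 4) ℂ)
        have hz : (LinearMap.toContinuousLinearMap (Λ i)) (0 : E) = 0 := map_zero (Λ i)
        rw [hz]
        exact this
      have h1 := h0.comp (0 : E) ((LinearMap.toContinuousLinearMap (Λ i)).hasStrictFDerivAt)
      exact (LinearMap.toContinuousLinearMap (LinearMap.mulRight ℝ
        (x i : Matrix (Fin 4) (Fin 4) ℂ))).hasStrictFDerivAt.comp (0 : E) h1)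
    (fun i => by simp)
  exact ⟨L, hL, fun v => hLv v _ fun i => rfl⟩
end BB

section CC

/-- Inverse of `toEuc` as a real linear map. -/
noncomputable def ccOfEuc (n : ℕ) :
    EuclideanSpace ℂ (QubitBasis n × QubitBasis n) →ₗ[ℝ] NMatrix n where
  toFun z := Matrix.of fun a b => z (a, b)
  map_add' _ _ := by ext; simp
  map_smul' _ _ := by ext; simp

theorem cc_bdd {n R : ℕ} (A : Architecture n R) : BddAbove (Set.range (rankAt A)) := by
  refine ⟨Module.finrank ℝ (NMatrix n), ?_⟩
  rintro _ ⟨x, rfl⟩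
  exact Submodule.finrank_le _

theorem cc_lower {n R : ℕ} (A : Architecture n R) : (rmax A : ℝ≥0∞) ≤ accessibleDim A := by
  obtain ⟨x, hx⟩ : ∃ x, rankAt A x = rmax A :=
    Nat.sSup_mem (Set.range_nonempty (rankAt A)) (cc_bdd A)
  rw [← hx]
  let S : Submodule ℝ (Fin R → Matrix (Fin 4) (Fin 4) ℂ) :=
    Submodule.pi Set.univ fun _ => suAlgebra (Fin 4)
  let T : Submodule ℝ (NMatrix n) := Submodule.map (contractDiff A x) S
  have hrk : rankAt A x = Module.finrank ℝ T := rfl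
  obtain ⟨g, hg⟩ := LinearMap.exists_leftInverse_of_injective T.subtype (Submodule.ker_subtype T)
  let eT := (Module.finBasis ℝ T).equivFun
  let eS := (Module.finBasis ℝ S).equivFun
  let Θ : NMatrix n →ₗ[ℝ] (Fin (Module.finrank ℝ T) → ℝ) := eT.toLinearMap ∘ₗ g
  let Λ : Fin R → (Fin (Module.finrank ℝ S) → ℝ) →ₗ[ℝ] Matrix (Fin 4) (Fin 4) ℂ :=
    fun i => LinearMap.proj i ∘ₗ S.subtype ∘ₗ eS.symm.toLinearMap
  have hΛ : ∀ i t, Λ i t ∈ suAlgebra (Fin 4) := by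
    intro i t
    exact (Submodule.mem_pi.1 (eS.symm t).2) i (Set.mem_univ i)
  obtain ⟨L, hL, hLv⟩ := bb_low A x Θ Λ
  have hsurj : L.range = ⊤ := by
    rw [LinearMap.range_eq_top]
    intro w
    obtain ⟨H, hH, hHt⟩ := (eT.symm w).2
    refine ⟨eS ⟨H, hH⟩, ?_⟩
    refine (hLv _).trans ?_
    have : (fun i => Λ i (eS ⟨H, hH⟩)) = H := by
      funext i
      simp [Λ]
    rw [this, hHt]
    have h2 := LinearMap.congr_fun hg (eT.symm w)
    change eT (g (T.subtype (eT.symm w))) = w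
    rw [← LinearMap.comp_apply, h2]
    simp
  have hnh := hL.map_nhds_eq_of_surj hsurj
  set G := (fun t => Θ ((List.ofFn fun i => embedGate (A i).1
        (NormedSpace.exp (Λ i t) * (x i : Matrix (Fin 4) (Fin 4) ℂ))).reverse.prod)) with hG
  have hmem : Set.range G ∈ nhds (G 0) := by
    rw [← hnh]
    exact Filter.range_mem_map
  have hdim := Real.dimH_of_mem_nhds hmem
  rw [Module.finrank_fin_fun] at hdim
  rw [hrk, ← hdim]
  let Ψ := LinearMap.toContinuousLinearMap (Θ ∘ₗ ccOfEuc n)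
  have hsub : Set.range G ⊆ Ψ '' (toEuc '' Set.range (contract A)) := by
    rintro _ ⟨t, rfl⟩
    refine ⟨_, ⟨_, ⟨fun i => ⟨NormedSpace.exp (Λ i t), bb_exp_mem _ (hΛ i t)⟩ * x i, rfl⟩, rfl⟩, ?_⟩
    rfl
  exact (dimH_mono hsub).trans (Ψ.lipschitz.dimH_image_le _)
end CC

section DD
open MvPolynomial

/-- Complex functions of real variables with polynomial real and imaginary parts. -/
noncomputable def ddSub (σ : Type) : Subring ((σ → ℝ) → ℂ) where
  carrier := {g | ∃ p q : MvPolynomial σ ℝ, ∀ x, g x = (eval x p : ℂ) + (eval x q : ℂ) * Complex.I}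
  mul_mem' := by
    rintro f g ⟨p, q, h⟩ ⟨p', q', h'⟩
    refine ⟨p * p' - q * q', p * q' + q * p', fun x => ?_⟩
    simp only [Pi.mul_apply, h, h', map_sub, map_mul, map_add]
    push_cast
    linear_combination ((eval x q : ℂ) * (eval x q' : ℂ)) * Complex.I_mul_I
  one_mem' := ⟨1, 0, fun x => by simp⟩
  add_mem' := by
    rintro f g ⟨p, q, h⟩ ⟨p', q', h'⟩
    refine ⟨p + p', q + q', fun x => ?_⟩
    simp only [Pi.add_apply, h, h', map_add]
    push_cast
    ring
  zero_mem' := ⟨0, 0, fun x => by simp⟩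
  neg_mem' := by
    rintro f ⟨p, q, h⟩
    refine ⟨-p, -q, fun x => ?_⟩
    simp only [Pi.neg_apply, h, map_neg]
    push_cast
    ring

theorem dd_conj {σ : Type} (g : (σ → ℝ) → ℂ) (hg : g ∈ ddSub σ) :
    (fun x => star (g x)) ∈ ddSub σ := by
  obtain ⟨p, q, h⟩ := hg
  refine ⟨p, -q, fun x => ?_⟩
  simp [h]

theorem dd_mul {σ m : Type} [Fintype m] (M N : (σ → ℝ) → Matrix m m ℂ)
    (hM : ∀ i j, (fun x => M x i j) ∈ ddSub σ) (hN : ∀ i j, (fun x => N x i j) ∈ ddSub σ) (i j : m) :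
    (fun x => (M x * N x) i j) ∈ ddSub σ := by
  have : (fun x => (M x * N x) i j) = ∑ k, (fun x => M x i k) * (fun x => N x k j) := by
    funext x
    simp [Matrix.mul_apply]
  rw [this]
  exact sum_mem fun k _ => mul_mem (hM i k) (hN k j)

theorem dd_one {σ m : Type} [Fintype m] [DecidableEq m] (i j : m) :
    (fun _ : σ → ℝ => (1 : Matrix m m ℂ) i j) ∈ ddSub σ := by
  by_cases h : i = j
  · subst h
    simp only [Matrix.one_apply_eq]
    exact one_mem (ddSub σ)
  · simp only [Matrix.one_apply_ne h]
    exact zero_mem (ddSub σ)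

theorem dd_list {σ m : Type} [Fintype m] [DecidableEq m] : ∀ (R : ℕ)
    (M : Fin R → (σ → ℝ) → Matrix m m ℂ)
    (_ : ∀ r i j, (fun x => M r x i j) ∈ ddSub σ) (i j : m),
    (fun x => ((List.ofFn fun r => M r x).reverse.prod) i j) ∈ ddSub σ := by
  intro R
  induction R with
  | zero =>
    intro M _ i j
    simpa using dd_one i j
  | succ R ih =>
    intro M hM i j
    have := dd_mul _ _ (ih (fun r => M r.succ) (fun r => hM r.succ)) (hM 0) i j
    simpa [List.ofFn_succ] using this

theorem dd_det {σ m : Type} [Fintype m] [DecidableEq m] (M : (σ → ℝ) → Matrix m m ℂ)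
    (hM : ∀ i j, (fun x => M x i j) ∈ ddSub σ) : (fun x => (M x).det) ∈ ddSub σ := by
  have : (fun x => (M x).det) = ∑ s : Equiv.Perm m, (((Equiv.Perm.sign s : ℤ)) : (σ → ℝ) → ℂ) *
      ∏ i, (fun x => M x (s i) i) := by
    funext x
    simp [Matrix.det_apply']
  rw [this]
  exact sum_mem fun s _ => mul_mem (intCast_mem _ _) (prod_mem fun i _ => hM _ _)

/-- The gate matrices encoded by real coordinates. -/
noncomputable def ddMat (R : ℕ) (r : Fin R) :
    (Fin R × Fin 4 × Fin 4 × Fin 2 → ℝ) →ₗ[ℝ] Matrix (Fin 4) (Fin 4) ℂ where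
  toFun x := Matrix.of fun i j => (x (r, i, j, 0) : ℂ) + (x (r, i, j, 1) : ℂ) * Complex.I
  map_add' x y := by
    ext i j
    simp
    ring
  map_smul' c x := by
    ext i j
    simp
    ring

theorem dd_mat_mem (R : ℕ) (r : Fin R) (i j : Fin 4) :
    (fun x => ddMat R r x i j) ∈ ddSub (Fin R × Fin 4 × Fin 4 × Fin 2) :=
  ⟨X (r, i, j, 0), X (r, i, j, 1), fun x => by simp [ddMat]⟩

theorem dd_mat_surj (R : ℕ) (M : Fin R → Matrix (Fin 4) (Fin 4) ℂ) :
    ∃ x, ∀ r, ddMat R r x = M r := by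
  refine ⟨fun q => if q.2.2.2 = 0 then (M q.1 q.2.1 q.2.2.1).re else (M q.1 q.2.1 q.2.2.1).im, ?_⟩
  intro r
  ext i j
  simp [ddMat, Complex.re_add_im]

/-- Real coordinates of a matrix. -/
noncomputable def ddCo (n : ℕ) :
    NMatrix n →ₗ[ℝ] ((QubitBasis n × QubitBasis n) × Fin 2 → ℝ) where
  toFun M := fun t => if t.2 = 0 then (M t.1.1 t.1.2).re else (M t.1.1 t.1.2).im
  map_add' M N := by
    funext t
    simp only [Matrix.add_apply, Pi.add_apply]
    split <;> simp
  map_smul' c M := by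
    funext t
    simp only [Matrix.smul_apply, Pi.smul_apply, RingHom.id_apply]
    split <;> simp

/-- Back from real coordinates. -/
noncomputable def ddBack (n : ℕ) :
    ((QubitBasis n × QubitBasis n) × Fin 2 → ℝ) →ₗ[ℝ]
      EuclideanSpace ℂ (QubitBasis n × QubitBasis n) where
  toFun w := WithLp.toLp 2 fun p => (w (p, 0) : ℂ) + (w (p, 1) : ℂ) * Complex.I
  map_add' x y := by
    ext i
    simp
    ring
  map_smul' c x := by
    ext i
    simp
    ring

theorem dd_back_co {n : ℕ} (M : NMatrix n) : ddBack n (ddCo n M) = toEuc M := by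
  ext p
  simp [ddBack, ddCo, toEuc, Complex.re_add_im]

theorem dd_contr {n R : ℕ} (A : Architecture n R) :
    ∃ Fp : (QubitBasis n × QubitBasis n) × Fin 2 → MvPolynomial (Fin R × Fin 4 × Fin 4 × Fin 2) ℝ,
      ∀ x t, eval x (Fp t) =
        ddCo n ((List.ofFn fun r => embedGate (A r).1 (ddMat R r x)).reverse.prod) t := by
  have h1 : ∀ i j, (fun x => ((List.ofFn fun r => embedGate (A r).1 (ddMat R r x)).reverse.prod) i j)
      ∈ ddSub (Fin R × Fin 4 × Fin 4 × Fin 2) := by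
    apply dd_list
    intro r i j
    unfold embedGate
    split_ifs
    · exact dd_mat_mem R r _ _
    · exact zero_mem (ddSub _)
  choose p q hpq using h1
  refine ⟨fun t => if t.2 = 0 then p t.1.1 t.1.2 else q t.1.1 t.1.2, ?_⟩
  intro x t
  have := hpq t.1.1 t.1.2 x
  simp only at this
  simp only [ddCo, LinearMap.coe_mk, AddHom.coe_mk, this]
  split <;> simp

theorem dd_tan {σ : Type} [Fintype σ] (Z : Set (σ → ℝ)) (x v : σ → ℝ)
    (hx : ∀ p : MvPolynomial σ ℝ, (∀ z ∈ Z, eval z p = 0) → eval x p = 0)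
    (hv : ∀ p : MvPolynomial σ ℝ, (∀ z ∈ Z, eval z p = 0) → ∑ i, eval x (pderiv i p) * v i = 0)
    (g : (σ → ℝ) → ℂ) (hg : g ∈ ddSub σ) (h0 : ∀ z ∈ Z, g z = 0) :
    g x = 0 ∧ HasDerivAt (fun t : ℝ => g (x + t • v)) 0 0 := by
  obtain ⟨p, q, h⟩ := hg
  have hp : ∀ z ∈ Z, eval z p = 0 := fun z hz => by
    have := congrArg Complex.re (h z)
    simpa [h0 z hz] using this.symm
  have hq : ∀ z ∈ Z, eval z q = 0 := fun z hz => by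
    have := congrArg Complex.im (h z)
    simpa [h0 z hz] using this.symm
  refine ⟨by rw [h, hx p hp, hx q hq]; simp, ?_⟩
  have hline : HasDerivAt (fun t : ℝ => x + t • v) v 0 := by
    simpa using ((hasDerivAt_id (0 : ℝ)).smul_const v).const_add x
  have key : ∀ p : MvPolynomial σ ℝ, (∀ z ∈ Z, eval z p = 0) →
      HasDerivAt (fun t : ℝ => eval (x + t • v) p) 0 0 := by
    intro p hp
    have h1 := (ud_eval_deriv p (x + (0 : ℝ) • v)).hasFDerivAt.comp_hasDerivAt (0 : ℝ) hline
    refine HasDerivAt.congr_deriv h1 ?_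
    refine Eq.trans ?_ (hv p hp)
    simp
  have := (key p hp).ofReal_comp.add ((key q hq).ofReal_comp.mul_const Complex.I)
  have e : (fun t : ℝ => g (x + t • v)) = (fun t : ℝ => ((eval (x + t • v) p : ℝ) : ℂ)) +
      (fun t : ℝ => ((eval (x + t • v) q : ℝ) : ℂ) * Complex.I) := by
    funext t
    simp [h]
  rw [e]
  exact HasDerivAt.congr_deriv this (by simp)

theorem dd_quad (P : Polynomial ℂ) (a b : ℂ) :
    HasDerivAt (fun t : ℝ => a + b * (t : ℂ) + P.eval (t : ℂ) * (t : ℂ) ^ 2) b 0 := by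
  have := ((Polynomial.C a + Polynomial.C b * Polynomial.X + P * Polynomial.X ^ 2).hasDerivAt
    ((0 : ℝ) : ℂ)).comp_ofReal
  simpa using this


theorem dd_su_tangent (R : ℕ) (Z : Set (Fin R × Fin 4 × Fin 4 × Fin 2 → ℝ))
    (hZ : Z = {z | ∀ r, ddMat R r z ∈ Matrix.specialUnitaryGroup (Fin 4) ℂ})
    (x v : Fin R × Fin 4 × Fin 4 × Fin 2 → ℝ)
    (hx : ∀ p : MvPolynomial _ ℝ, (∀ z ∈ Z, eval z p = 0) → eval x p = 0)
    (hv : ∀ p : MvPolynomial _ ℝ, (∀ z ∈ Z, eval z p = 0) → ∑ i, eval x (pderiv i p) * v i = 0)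
    (r : Fin R) :
    ddMat R r x ∈ Matrix.specialUnitaryGroup (Fin 4) ℂ ∧
    ddMat R r v * (ddMat R r x)ᴴ ∈ suAlgebra (Fin 4) := by
  have hlin : ∀ t : ℝ, ddMat R r (x + t • v) = ddMat R r x + (t : ℂ) • ddMat R r v := by
    intro t
    rw [map_add, map_smul]
    ext i j
    simp
  have hU : ∀ i j, (fun z => ((ddMat R r z)ᴴ * ddMat R r z) i j - (1 : Matrix (Fin 4) (Fin 4) ℂ) i j)
      ∈ ddSub (Fin R × Fin 4 × Fin 4 × Fin 2) := by
    intro i j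
    refine sub_mem (dd_mul (fun z => (ddMat R r z)ᴴ) (fun z => ddMat R r z) ?_ (dd_mat_mem R r) i j)
      (dd_one i j)
    intro i j
    exact dd_conj _ (dd_mat_mem R r j i)
  have hD : (fun z => (ddMat R r z).det - 1) ∈ ddSub (Fin R × Fin 4 × Fin 4 × Fin 2) :=
    sub_mem (dd_det _ (dd_mat_mem R r)) (one_mem _)
  have tU := fun i j => dd_tan Z x v hx hv _ (hU i j) (by
    intro z hz
    rw [hZ] at hz
    have h1 := (Matrix.mem_unitaryGroup_iff'.1 (Matrix.mem_specialUnitaryGroup_iff.1 (hz r)).1)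
    rw [Matrix.star_eq_conjTranspose] at h1
    simp only [h1, sub_self])
  have tD := dd_tan Z x v hx hv _ hD (by
    intro z hz
    rw [hZ] at hz
    have h1 := (Matrix.mem_specialUnitaryGroup_iff.1 (hz r)).2
    simp only [h1, sub_self])
  set u := ddMat R r x with hu
  set W := ddMat R r v with hW
  have huu : uᴴ * u = 1 := by
    ext i j
    exact sub_eq_zero.1 (tU i j).1
  have huu' : u * uᴴ = 1 := mul_eq_one_comm.1 huu
  have hdet : u.det = 1 := sub_eq_zero.1 tD.1
  refine ⟨?_, ?_⟩
  · rw [Matrix.mem_specialUnitaryGroup_iff, Matrix.mem_unitaryGroup_iff',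
      Matrix.star_eq_conjTranspose]
    exact ⟨huu, hdet⟩
  have hskew : Wᴴ * u + uᴴ * W = 0 := by
    ext i j
    have h1 := (tU i j).2
    have h2 := dd_quad (Polynomial.C ((Wᴴ * W) i j)) 0 ((Wᴴ * u + uᴴ * W) i j)
    have e : (fun t : ℝ => ((ddMat R r (x + t • v))ᴴ * ddMat R r (x + t • v)) i j -
        (1 : Matrix (Fin 4) (Fin 4) ℂ) i j) = (fun t : ℝ => 0 + (Wᴴ * u + uᴴ * W) i j * (t : ℂ) +
        (Polynomial.C ((Wᴴ * W) i j)).eval (t : ℂ) * (t : ℂ) ^ 2) := by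
      funext t
      rw [hlin, Matrix.conjTranspose_add, Matrix.conjTranspose_smul, add_mul, mul_add, mul_add, huu]
      simp only [Matrix.add_apply, Matrix.smul_mul, Matrix.mul_smul, Matrix.smul_apply,
        smul_eq_mul, Polynomial.eval_C, Complex.star_def, Complex.conj_ofReal]
      ring
    rw [e] at h1
    exact h2.unique h1
  have htr : (uᴴ * W).trace = 0 := by
    have h1 := tD.2
    have h2 := dd_quad (Matrix.det (1 + (Polynomial.X : Polynomial ℂ) • (uᴴ * W).map Polynomial.C)).divX.divX
      0 ((uᴴ * W).trace)
    have e : (fun t : ℝ => (ddMat R r (x + t • v)).det - 1) = (fun t : ℝ => 0 +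
        (uᴴ * W).trace * (t : ℂ) +
        (Matrix.det (1 + (Polynomial.X : Polynomial ℂ) • (uᴴ * W).map Polynomial.C)).divX.divX.eval
          (t : ℂ) * (t : ℂ) ^ 2) := by
      funext t
      have h3 : ddMat R r (x + t • v) = u * (1 + (t : ℂ) • (uᴴ * W)) := by
        rw [hlin, mul_add, mul_one, Matrix.mul_smul, ← mul_assoc, huu', one_mul]
      rw [h3, Matrix.det_mul, hdet, Matrix.det_one_add_smul]
      ring
    rw [e] at h1
    exact h2.unique h1
  rw [bb_su_mem]
  refine ⟨?_, ?_⟩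
  · rw [Matrix.conjTranspose_mul, Matrix.conjTranspose_conjTranspose]
    have h1 : Wᴴ * u = -(uᴴ * W) := eq_neg_of_add_eq_zero_left hskew
    calc u * Wᴴ = u * (Wᴴ * u) * uᴴ := by rw [mul_assoc, mul_assoc, huu', mul_one]
      _ = -((u * uᴴ) * W * uᴴ) := by rw [h1]; simp [mul_assoc]
      _ = _ := by rw [huu', one_mul]
  · rw [Matrix.trace_mul_comm, htr]

theorem dd_upper {n R : ℕ} (A : Architecture n R) : accessibleDim A ≤ (rmax A : ℝ≥0∞) := by
  obtain ⟨Fp, hFp⟩ := dd_contr A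
  obtain ⟨Z, hZ⟩ : ∃ Z : Set (Fin R × Fin 4 × Fin 4 × Fin 2 → ℝ),
      Z = {z | ∀ r, ddMat R r z ∈ Matrix.specialUnitaryGroup (Fin 4) ℂ} := ⟨_, rfl⟩
  let I0 : Ideal (MvPolynomial (Fin R × Fin 4 × Fin 4 × Fin 2) ℝ) :=
    { carrier := {p | ∀ z ∈ Z, eval z p = 0}
      add_mem' := by
        intro a b ha hb z hz
        rw [map_add, ha z hz, hb z hz, add_zero]
      zero_mem' := by
        intro z hz
        simp
      smul_mem' := by
        intro c p hp z hz
        rw [smul_eq_mul, map_mul, hp z hz, mul_zero] }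
  have hmain := ud_upper Fp I0 (rmax A) (by
    intro x hx s v hv hc
    obtain ⟨c, hc0, hc⟩ := hc
    have hst : ∀ a r, _ := fun (a : s) r => dd_su_tangent R Z hZ x (v a) hx (hv a) r
    by_cases hs : IsEmpty s
    · simp
    rw [not_isEmpty_iff] at hs
    obtain ⟨a0⟩ := hs
    let X : Fin R → SU4 := fun r => ⟨ddMat R r x, (hst a0 r).1⟩
    let H : s → Fin R → Matrix (Fin 4) (Fin 4) ℂ := fun a r => ddMat R r (v a) * (ddMat R r x)ᴴ
    obtain ⟨L, hL, hLv⟩ := bb_up A X (ddCo n) x (ddMat R) (fun _ => rfl)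
    have hLH : ∀ a, L (v a) = ddCo n (contractDiff A X (H a)) := by
      intro a
      refine hLv (v a) (H a) fun r => ?_
      have h1 := (Matrix.mem_unitaryGroup_iff'.1 (Matrix.mem_specialUnitaryGroup_iff.1 (X r).2).1)
      rw [Matrix.star_eq_conjTranspose] at h1
      change _ = ddMat R r (v a) * (X r : Matrix (Fin 4) (Fin 4) ℂ)ᴴ * (X r : Matrix (Fin 4) (Fin 4) ℂ)
      rw [mul_assoc, h1, mul_one]
    have hLt : ∀ w t, L w t = ∑ i, eval x (pderiv i (Fp t)) * w i := by
      intro w t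
      have h1 := hasFDerivAt_pi'.1 hL.hasFDerivAt t
      have h2 := (ud_eval_deriv (Fp t) x).hasFDerivAt
      have e : (fun y => eval y (Fp t)) = fun y =>
        ddCo n ((List.ofFn fun r => embedGate (A r).1 (ddMat R r y)).reverse.prod) t := by
        funext y
        exact hFp y t
      rw [e] at h2
      have h3 := congrArg (fun M => M w) (h1.unique h2)
      simpa using h3
    let T : Submodule ℝ (NMatrix n) := Submodule.map (contractDiff A X)
      (Submodule.pi Set.univ fun _ => suAlgebra (Fin 4))
    have hT : ∀ a, contractDiff A X (H a) ∈ T := fun a =>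
      Submodule.mem_map_of_mem (Submodule.mem_pi.2 fun r _ => (hst a r).2)
    have hli : LinearIndependent ℝ (fun a : s => (⟨contractDiff A X (H a), hT a⟩ : T)) := by
      rw [Fintype.linearIndependent_iff]
      intro k hk b
      have h1 := congrArg (fun z : T => ddCo n (z : NMatrix n) b) hk
      simp only [Submodule.coe_sum, Submodule.coe_smul, map_sum, map_smul, Finset.sum_apply,
        Pi.smul_apply, smul_eq_mul, Submodule.coe_zero, map_zero, Pi.zero_apply, ← hLH, hLt] at h1
      rw [Finset.sum_eq_single b] at h1
      · rw [(hc b b).1 rfl] at h1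
        exact (mul_eq_zero.1 h1).resolve_right hc0
      · intro a _ hab
        rw [(hc a b).2 hab, mul_zero]
      · intro h
        exact absurd (Finset.mem_univ b) h
    rw [Nat.card_eq_fintype_card]
    exact (hli.fintype_card_le_finrank).trans (le_ciSup (cc_bdd A) X)) I0 le_rfl
  refine le_trans ?_ hmain
  let Ψ := LinearMap.toContinuousLinearMap (ddBack n)
  refine le_trans (dimH_mono ?_) (Ψ.lipschitz.dimH_image_le _)
  rintro _ ⟨_, ⟨X, rfl⟩, rfl⟩
  obtain ⟨x, hx⟩ := dd_mat_surj R (fun r => (X r : Matrix (Fin 4) (Fin 4) ℂ))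
  refine ⟨_, ⟨x, ?_, rfl⟩, ?_⟩
  · intro p hp
    refine hp x ?_
    rw [hZ]
    intro r
    rw [hx]
    exact (X r).2
  · have e : (fun t => eval x (Fp t)) = ddCo n (contract A X) := by
      funext t
      rw [hFp]
      simp only [hx]
      rfl
    change ddBack n (fun t => eval x (Fp t)) = _
    rw [e, dd_back_co]
end DD

/-- **Accessible dimension equals maximal rank.**  For every `n`-qubit architecture `A` with
`R` gates, the Hausdorff dimension of `U(A)` (in the Frobenius metric) equals the maximal
rank of the differential of the contraction map `F^A`. -/
theorem accessible_dimension_eq_rmax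
    (n R : ℕ) (hn : 2 ≤ n) (A : Architecture n R) :
    accessibleDim A = (rmax A : ℝ≥0∞) := le_antisymm (dd_upper A) (cc_lower A)
end
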